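/- arXiv:1011.1557 — 2 statements merged into one kernel-verified Lean document; each statement's English description precedes it below -/
import Mathlib

section
/- For every natural number m ≥ 1, the variety D_m = var{x^m = 0, xy = yx} is a definable element of the lattice Com. -/
open FirstOrder

/-! ### Words, identities, and commutative semigroup varieties -/

/-- Semigroup words over the countable alphabet `ℕ`. -/
abbrev SGWord : Type := FreeSemigroup ℕ

/-- A semigroup identity `u = v` is a pair of words. -/
abbrev SGId : Type := SGWord × SGWord

/-- The one-letter word consisting of the letter `n`. -/
def ltr (n : ℕ) : SGWord := FreeSemigroup.of n

/-- `wpow w n` is the word `w^n` (for `n ≥ 1`; by convention `wpow w 0 = w`). -/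
def wpow (w : SGWord) : ℕ → SGWord
  | 0 => w
  | 1 => w
  | n + 2 => wpow w (n + 1) * w

/-- The letter `n` occurs in the word `w`. -/
def OccursIn (n : ℕ) (w : SGWord) : Prop := n = w.head ∨ n ∈ w.tail

/-- A semigroup `S` satisfies the identity `i.1 = i.2` if all evaluations of the two
words in `S` coincide. -/
def SGSatisfies (S : Type) [Semigroup S] (i : SGId) : Prop :=
  ∀ f : ℕ → S, FreeSemigroup.lift f i.1 = FreeSemigroup.lift f i.2

/-- A bundled (nonempty) commutative semigroup. -/
structure ComSG where
  carrier : Type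
  [str : CommSemigroup carrier]
  [instNonempty : Nonempty carrier]

attribute [instance] ComSG.str ComSG.instNonempty

/-- The class of commutative semigroups satisfying every identity in `E`. -/
def modelsOf (E : Set SGId) : Set ComSG := {S | ∀ i ∈ E, SGSatisfies S.carrier i}

/-- The set of identities holding in every member of the class `K`. -/
def theoryOfClass (K : Set ComSG) : Set SGId := {i | ∀ S ∈ K, SGSatisfies S.carrier i}

theorem subset_theoryOfClass_modelsOf (E : Set SGId) : E ⊆ theoryOfClass (modelsOf E) :=
  fun i hi S hS => hS i hi

theorem theoryOfClass_antitone {K K' : Set ComSG} (h : K ⊆ K') :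
    theoryOfClass K' ⊆ theoryOfClass K := fun _ hi S hS => hi S (h hS)

theorem modelsOf_antitone {E E' : Set SGId} (h : E ⊆ E') : modelsOf E' ⊆ modelsOf E :=
  fun _ hS i hi => hS i (h hi)

/-- A variety of commutative semigroups, identified with its (equationally closed)
equational theory.  Varieties are ordered by inclusion of the corresponding classes
of semigroups, i.e. by *reverse* inclusion of theories. -/
structure ComVariety where
  theory : Set SGId
  closed : theoryOfClass (modelsOf theory) = theory

theorem ComVariety.ext' {V W : ComVariety} (h : V.theory = W.theory) : V = W := by
  cases V; cases W; cases h; rfl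

instance : PartialOrder ComVariety where
  le V W := W.theory ⊆ V.theory
  le_refl V := subset_rfl
  le_trans U V W h1 h2 := fun i hi => h1 (h2 hi)
  le_antisymm V W h1 h2 := ComVariety.ext' (subset_antisymm h2 h1)

instance : SupSet ComVariety where
  sSup s :=
    { theory := ⋂ V ∈ s, V.theory
      closed := by
        apply subset_antisymm
        · intro i hi
          refine Set.mem_iInter₂.2 fun V hV => ?_
          have h1 : (⋂ V ∈ s, ComVariety.theory V) ⊆ V.theory := Set.biInter_subset_of_mem hV
          have h2 := theoryOfClass_antitone (modelsOf_antitone h1)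
          rw [V.closed] at h2
          exact h2 hi
        · exact subset_theoryOfClass_modelsOf _ }

/-- The lattice **Com** of all commutative semigroup varieties. -/
instance : CompleteLattice ComVariety :=
  completeLatticeOfSup ComVariety fun s => by
    constructor
    · intro V hV i hi
      exact Set.mem_iInter₂.1 hi V hV
    · intro W hW i hi
      exact Set.mem_iInter₂.2 fun V hV => hW hV hi

/-- The variety of commutative semigroups given by the identity system `E`. -/
def comVar (E : Set SGId) : ComVariety where
  theory := theoryOfClass (modelsOf E)
  closed := by
    apply subset_antisymm
    · exact theoryOfClass_antitone fun S hS i hi => hi S hS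
    · exact subset_theoryOfClass_modelsOf _

/-! ### The first-order language of lattices and definability -/

/-- The first-order language of lattices: two binary function symbols (`true` for the
join `∨` and `false` for the meet `∧`) and nothing else. -/
def latticeLang : Language where
  Functions := fun n => match n with | 2 => Bool | _ => Empty
  Relations := fun _ => Empty

instance latticeLangStructure (L : Type*) [Lattice L] : latticeLang.Structure L where
  funMap {n} f x :=
    match n, f with
    | 2, b => bif b then x 0 ⊔ x 1 else x 0 ⊓ x 1
    | 0, f => f.elim
    | 1, f => f.elim
    | (_ + 3), f => f.elim
  RelMap {n} r _ := r.elim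

/-- A subset `A` of a lattice `L` is definable in `L` if there is a first-order formula
`φ(x)` with one free variable in the language of the lattice operations `∨` and `∧`
such that for every `a ∈ L`, `φ(a)` holds in `L` if and only if `a ∈ A`. -/
def LatDefinable (L : Type*) [Lattice L] (A : Set L) : Prop :=
  ∃ φ : latticeLang.Formula (Fin 1), ∀ a : L, (φ.Realize fun _ => a) ↔ a ∈ A

/-! ### Named varieties -/

/-- The commutativity identity `xy = yx`. -/
def commId : SGId := (ltr 0 * ltr 1, ltr 1 * ltr 0)

/-- The pair of identities abbreviated by the symbolic identity `w = 0`, namely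
`wx = w` and `xw = w`, where `x` is the letter `n` (assumed not to occur in `w`). -/
def zeroId (w : SGWord) (n : ℕ) : Set SGId := {(w * ltr n, w), (ltr n * w, w)}

/-- `A n = var{xⁿy = y, xy = yx}`, the variety of Abelian groups of exponent dividing `n`. -/
def Avar (n : ℕ) : ComVariety := comVar {(wpow (ltr 0) n * ltr 1, ltr 1), commId}

/-- `SL = var{x² = x, xy = yx}`, the variety of semilattices. -/
def SLvar : ComVariety := comVar {(wpow (ltr 0) 2, ltr 0), commId}

/-- `ZM = var{xy = 0}` (within **Com**), the variety of null semigroups. -/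
def ZMvar : ComVariety := comVar ({commId} ∪ zeroId (ltr 0 * ltr 1) 2)

/-- `T = var{x = y}`, the trivial variety. -/
def Tvar : ComVariety := comVar {(ltr 0, ltr 1)}

/-- `COM`, the variety of all commutative semigroups. -/
def COMvar : ComVariety := comVar {commId}

/-- `C m = var{xᵐ = xᵐ⁺¹, xy = yx}` (the variety generated by the cyclic monoid
`⟨a ∣ aᵐ = aᵐ⁺¹⟩`), with the convention `C 0 = T`. -/
def Cvar : ℕ → ComVariety
  | 0 => Tvar
  | m + 1 => comVar {(wpow (ltr 0) (m + 1), wpow (ltr 0) (m + 2)), commId}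

/-- `D m = var{xᵐ = 0, xy = yx}`. -/
def Dvar (m : ℕ) : ComVariety := comVar ({commId} ∪ zeroId (wpow (ltr 0) m) 1)

/-- The word `x₁x₂⋯x_k` (in the letters `0, 1, …, k-1`), for `k ≥ 1`. -/
def chainWord : ℕ → SGWord
  | 0 => ltr 0
  | 1 => ltr 0
  | k + 2 => chainWord (k + 1) * ltr (k + 1)

/-- `N k = var{x² = x₁x₂⋯x_k = 0, xy = yx}`. -/
def Nvar (k : ℕ) : ComVariety :=
  comVar ({commId} ∪ zeroId (wpow (ltr 0) 2) 1 ∪ zeroId (chainWord k) k)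

/-- `N_ω = var{x² = 0, xy = yx}`. -/
def Nomegavar : ComVariety := comVar ({commId} ∪ zeroId (wpow (ltr 0) 2) 1)

/-- `N₃ᶜ = var{xyz = 0, xy = yx}`. -/
def N3cvar : ComVariety := comVar ({commId} ∪ zeroId (ltr 0 * ltr 1 * ltr 2) 3)

/-! ### Semantic notions -/

/-- A semigroup `S` belongs to the variety `V` if it satisfies every identity of `V`. -/
def VMem (S : Type) [Semigroup S] (V : ComVariety) : Prop :=
  ∀ i ∈ V.theory, SGSatisfies S i

/-- `spow a n` is the power `aⁿ` in a semigroup (for `n ≥ 1`; by convention `spow a 0 = a`). -/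
def spow {S : Type} [Semigroup S] (a : S) : ℕ → S
  | 0 => a
  | 1 => a
  | n + 2 => spow a (n + 1) * a

/-- A semigroup is a group. -/
def IsGroupSG (S : Type) [Semigroup S] : Prop :=
  ∃ e : S, (∀ a, e * a = a ∧ a * e = a) ∧ ∀ a, ∃ b, a * b = e ∧ b * a = e

/-- A semigroup is periodic: every element generates a finite cyclic subsemigroup. -/
def IsPeriodicSG (S : Type) [Semigroup S] : Prop :=
  ∀ a : S, ∃ i j : ℕ, 1 ≤ i ∧ i < j ∧ spow a i = spow a j

/-- A semigroup is a nil-semigroup: it has a zero element and every element has a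
power equal to zero. -/
def IsNilSG (S : Type) [Semigroup S] : Prop :=
  ∃ z : S, (∀ a, z * a = z ∧ a * z = z) ∧ ∀ a, ∃ n, 1 ≤ n ∧ spow a n = z

/-- A variety all of whose members are groups. -/
def IsGroupVariety (V : ComVariety) : Prop := ∀ S ∈ modelsOf V.theory, IsGroupSG S.carrier

/-- A variety all of whose members are periodic semigroups. -/
def IsPeriodicVariety (V : ComVariety) : Prop := ∀ S ∈ modelsOf V.theory, IsPeriodicSG S.carrier

/-- A nil-variety: a variety all of whose members are nil-semigroups. -/
def IsNilVariety (V : ComVariety) : Prop := ∀ S ∈ modelsOf V.theory, IsNilSG S.carrier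

/-- A combinatorial variety: all groups in it are trivial. -/
def IsCombinatorial (V : ComVariety) : Prop :=
  ∀ S ∈ modelsOf V.theory, IsGroupSG S.carrier → ∀ a b : S.carrier, a = b

/-- `K` is the variety generated by the semigroup `M` (with explicit semigroup
structure `inst`): the smallest variety containing `M`. -/
def GeneratedBy (M : Type) (inst : Semigroup M) (K : ComVariety) : Prop :=
  IsLeast {W : ComVariety | ∀ i ∈ W.theory, @SGSatisfies M inst i} K

/-- A neutral element of a lattice. -/
def IsNeutralElt {α : Type*} [Lattice α] (x : α) : Prop :=
  ∀ y z, (x ⊔ y) ⊓ (y ⊔ z) ⊓ (z ⊔ x) = (x ⊓ y) ⊔ (y ⊓ z) ⊔ (z ⊓ x)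

/-- A chain variety: a variety whose lattice of subvarieties is a chain. -/
def IsChainVariety (V : ComVariety) : Prop :=
  ∀ W₁ W₂ : ComVariety, W₁ ≤ V → W₂ ≤ V → W₁ ≤ W₂ ∨ W₂ ≤ W₁

/-- A variety is 0-reduced in **Com** if it is given within `COM` by 0-reduced
identities (identities of the form `w = 0`) only. -/
def IsZeroReduced (V : ComVariety) : Prop :=
  ∃ P : Set (SGWord × ℕ), (∀ p ∈ P, ¬ OccursIn p.2 p.1) ∧
    V = comVar (⋃ p ∈ P, zeroId p.1 p.2)

/-- `ZR V`: the least variety 0-reduced in **Com** that contains `V`. -/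
def ZRv (V : ComVariety) : ComVariety := sInf {W : ComVariety | IsZeroReduced W ∧ V ≤ W}


namespace ComVariety

variable {V W : ComVariety}

/-! ### Words and their evaluations -/

/-- The exponent vector of a word. -/
noncomputable def expo (u : SGWord) : ℕ →₀ ℕ :=
  Multiplicative.toAdd
    (FreeSemigroup.lift (fun n => Multiplicative.ofAdd (Finsupp.single n 1)) u)

theorem expo_ltr (n : ℕ) : expo (ltr n) = Finsupp.single n 1 := by
  simp [expo, ltr]

theorem expo_mul (u v : SGWord) : expo (u * v) = expo u + expo v := by
  simp [expo]

theorem expo_wpow_succ (w : SGWord) (k : ℕ) : expo (wpow w (k + 1)) = (k + 1) • expo w := by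
  induction k with
  | zero => simp [wpow]
  | succ k ih => rw [wpow, expo_mul, ih, add_smul (k + 1) 1, one_smul]

theorem lift_eq_prod {M : Type*} [CommMonoid M] (g : ℕ → M) (u : SGWord) :
    FreeSemigroup.lift g u = (expo u).prod fun x e => g x ^ e := by
  induction u using FreeSemigroup.recOnMul with
  | ih1 x =>
    change _ = (expo (ltr x)).prod _
    rw [expo_ltr, Finsupp.prod_single_index] <;> simp
  | ih2 x y hx hy =>
    rw [map_mul, hx, hy, expo_mul, Finsupp.prod_add_index'] <;> simp [pow_add]

theorem lift_eq_prod_of_subset {M : Type*} [CommMonoid M] (g : ℕ → M) (u : SGWord)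
    {F : Finset ℕ} (hF : (expo u).support ⊆ F) :
    FreeSemigroup.lift g u = ∏ x ∈ F, g x ^ expo u x := by
  rw [lift_eq_prod, Finsupp.prod_of_support_subset _ hF]
  simp

theorem lift_congr {M : Type*} [CommMonoid M] (g : ℕ → M) {u v : SGWord}
    (h : ∀ x, g x ^ expo u x = g x ^ expo v x) :
    FreeSemigroup.lift g u = FreeSemigroup.lift g v := by
  rw [lift_eq_prod_of_subset g u Finset.subset_union_left,
    lift_eq_prod_of_subset g v Finset.subset_union_right]
  exact Finset.prod_congr rfl fun x _ => h x

theorem exists_lift_ite (x : ℕ) (u : SGWord) :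
    ∃ q : ℕ, ∀ (M : Type) [CommMonoid M] (a b : M),
      FreeSemigroup.lift (fun n => if n = x then a else b) u = a ^ expo u x * b ^ q := by
  induction u using FreeSemigroup.recOnMul with
  | ih1 y =>
    change ∃ q : ℕ, ∀ (M : Type) [CommMonoid M] (a b : M), _ = a ^ expo (ltr y) x * b ^ q
    by_cases h : y = x
    · exact ⟨0, fun M _ a b => by simp [h, expo_ltr]⟩
    · exact ⟨1, fun M _ a b => by simp [h, expo_ltr]⟩
  | ih2 y z hy hz =>
    obtain ⟨p, hp⟩ := hy
    obtain ⟨q, hq⟩ := hz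
    refine ⟨p + q, fun M _ a b => ?_⟩
    rw [map_mul, hp, hq, expo_mul, Finsupp.add_apply, pow_add, pow_add, mul_mul_mul_comm]

theorem coe_lift {S : Type*} [CommSemigroup S] (f : ℕ → S) (u : SGWord) :
    ((FreeSemigroup.lift f u : S) : WithOne S) =
      FreeSemigroup.lift (fun n => (f n : WithOne S)) u := by
  induction u using FreeSemigroup.recOnMul with
  | ih1 y => simp
  | ih2 y z hy hz => rw [map_mul, map_mul, WithOne.coe_mul, hy, hz]

theorem coe_lift_ite {S : Type*} [CommSemigroup S] (x : ℕ) (a b : S) (u : SGWord) :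
    ((FreeSemigroup.lift (fun n => if n = x then a else b) u : S) : WithOne S) =
      FreeSemigroup.lift (fun n => if n = x then (a : WithOne S) else b) u := by
  rw [coe_lift]
  congr 2
  funext n
  split_ifs <;> rfl

theorem lift_wpow_succ {M : Type*} [Monoid M] (g : ℕ → M) (w : SGWord) (k : ℕ) :
    FreeSemigroup.lift g (wpow w (k + 1)) = FreeSemigroup.lift g w ^ (k + 1) := by
  induction k with
  | zero => simp [wpow]
  | succ k ih => rw [wpow, map_mul, ih, ← pow_succ]

theorem lift_lift {S : Type*} [Semigroup S] (f : ℕ → S) (σ : ℕ → SGWord) (u : SGWord) :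
    FreeSemigroup.lift f (FreeSemigroup.lift σ u) =
      FreeSemigroup.lift (fun n => FreeSemigroup.lift f (σ n)) u := by
  induction u using FreeSemigroup.recOnMul with
  | ih1 y => simp
  | ih2 y z hy hz => simp only [map_mul, hy, hz]

theorem exists_coe_eq_pow_succ {S : Type*} [CommSemigroup S] (b : S) (k : ℕ) :
    ∃ c : S, (c : WithOne S) = (b : WithOne S) ^ (k + 1) := by
  induction k with
  | zero => exact ⟨b, by simp⟩
  | succ k ih =>
    obtain ⟨c, hc⟩ := ih
    exact ⟨c * b, by rw [WithOne.coe_mul, hc, ← pow_succ]⟩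

/-- If `y ^ (r + n) = y ^ r`, powers of `y` beyond `r` depend on the exponent modulo `n`. -/
theorem pow_eq_pow_of_period {M : Type*} [Monoid M] {y : M} {r n : ℕ} (h : y ^ (r + n) = y ^ r)
    {i j : ℕ} (hi : r ≤ i) (hj : r ≤ j) (hij : i ≡ j [MOD n]) : y ^ i = y ^ j := by
  have key : ∀ k i : ℕ, r ≤ i → y ^ (i + n * k) = y ^ i := by
    intro k
    induction k with
    | zero => simp
    | succ k ih =>
      intro i hi
      obtain ⟨d, rfl⟩ := Nat.exists_eq_add_of_le hi
      rw [← ih (r + d) hi, show r + d + n * (k + 1) = (r + n) + (d + n * k) by ring, pow_add, h,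
        ← pow_add, add_assoc]
  rcases le_total i j with hle | hle
  · obtain ⟨k, hk⟩ := (Nat.modEq_iff_dvd' hle).1 hij
    rw [show j = i + n * k by omega, key k i hi]
  · obtain ⟨k, hk⟩ := (Nat.modEq_iff_dvd' hle).1 hij.symm
    rw [show i = j + n * k by omega, key k j hj]

/-! ### Theories and models -/

theorem mem_theory_iff {u v : SGWord} : (u, v) ∈ V.theory ↔
    ∀ S ∈ modelsOf V.theory, SGSatisfies S.carrier (u, v) := by
  conv_lhs => rw [← V.closed]
  rfl

theorem theory_symm {u v : SGWord} (h : (u, v) ∈ V.theory) : (v, u) ∈ V.theory :=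
  mem_theory_iff.2 fun _ hS f => (hS _ h f).symm

theorem le_of_models (h : ∀ S ∈ modelsOf V.theory, S ∈ modelsOf W.theory) : V ≤ W :=
  fun _ hi => mem_theory_iff.2 fun S hS => h S hS _ hi

theorem mem_sup_theory {u v : SGWord} (hV : (u, v) ∈ V.theory) (hW : (u, v) ∈ W.theory) :
    (u, v) ∈ (V ⊔ W).theory := by
  let X : ComVariety := SupSet.sSup {V, W}
  have h : V ⊔ W ≤ X := by
    refine sup_le (fun i hi => ?_) (fun i hi => ?_)
    · exact Set.mem_iInter₂.1 hi V (by simp)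
    · exact Set.mem_iInter₂.1 hi W (by simp)
  refine h (Set.mem_iInter₂.2 ?_)
  rintro U (rfl | rfl)
  exacts [hV, hW]

theorem exists_expo_ne_of_ne_top (h : V ≠ ⊤) :
    ∃ u v x, (u, v) ∈ V.theory ∧ expo u x ≠ expo v x := by
  by_contra! hc
  refine h (top_le_iff.1 fun i hi => ?_)
  refine mem_theory_iff.2 fun S _ f => WithOne.coe_inj.1 ?_
  rw [coe_lift, coe_lift]
  exact lift_congr _ fun x => by rw [hc i.1 i.2 x hi]

theorem eq_bot_of_subsingleton
    (h : ∀ S ∈ modelsOf V.theory, ∀ a b : S.carrier, a = b) : V = ⊥ :=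
  le_bot_iff.1 fun _ _ => mem_theory_iff.2 fun S hS _ => h S hS _ _

/-- The variety generated by one commutative semigroup. -/
def gen (S : Type) [CommSemigroup S] [Nonempty S] : ComVariety where
  theory := {i | SGSatisfies S i}
  closed := subset_antisymm (fun _ hi => hi ⟨S⟩ fun _ hj => hj) (subset_theoryOfClass_modelsOf _)

theorem mem_gen_theory_iff {M : Type} [CommMonoid M] {u v : SGWord} :
    (u, v) ∈ (gen M).theory ↔ ∀ x (g : M), g ^ expo u x = g ^ expo v x := by
  refine ⟨fun h x g => ?_, fun h f => lift_congr f fun x => h x (f x)⟩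
  obtain ⟨p, hp⟩ := exists_lift_ite x u
  obtain ⟨q, hq⟩ := exists_lift_ite x v
  simpa [hp, hq] using h (fun n => if n = x then g else 1)

/-! ### Periodic varieties -/

/-- The variety satisfies `x ^ (r + n) = x ^ r`. -/
def HasPeriod (V : ComVariety) (r n : ℕ) : Prop :=
  ∀ S ∈ modelsOf V.theory, ∀ a : S.carrier, (a : WithOne S.carrier) ^ (r + n) = a ^ r

/-- The variety satisfies `x ^ (m + n) * y ^ k = x ^ m * y ^ k`. -/
def HasLaw (V : ComVariety) (n m k : ℕ) : Prop :=
  ∀ S ∈ modelsOf V.theory, ∀ a b : S.carrier,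
    (a : WithOne S.carrier) ^ (m + n) * b ^ k = a ^ m * b ^ k

theorem HasLaw.mono {n m k m' k' : ℕ} (h : V.HasLaw n m k) (hm : m ≤ m') (hk : k ≤ k') :
    V.HasLaw n m' k' := by
  intro S hS a b
  obtain ⟨i, rfl⟩ := Nat.exists_eq_add_of_le hm
  obtain ⟨j, rfl⟩ := Nat.exists_eq_add_of_le hk
  have := congrArg (· * ((a : WithOne S.carrier) ^ i * b ^ j)) (h S hS a b)
  calc (a : WithOne S.carrier) ^ (m + i + n) * b ^ (k + j)
      = a ^ (m + n) * b ^ k * (a ^ i * b ^ j) := by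
        rw [mul_mul_mul_comm, ← pow_add, ← pow_add, Nat.add_right_comm]
    _ = a ^ m * b ^ k * (a ^ i * b ^ j) := this
    _ = _ := by rw [mul_mul_mul_comm, ← pow_add, ← pow_add]

theorem exists_eval_two {u v : SGWord} (h : (u, v) ∈ V.theory) (x : ℕ) :
    ∃ p q : ℕ, ∀ S ∈ modelsOf V.theory, ∀ a b : S.carrier,
      (a : WithOne S.carrier) ^ expo u x * b ^ p = a ^ expo v x * b ^ q := by
  obtain ⟨p, hp⟩ := exists_lift_ite x u
  obtain ⟨q, hq⟩ := exists_lift_ite x v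
  refine ⟨p, q, fun S hS a b => ?_⟩
  rw [← hp, ← hq, ← coe_lift_ite, ← coe_lift_ite]
  exact congrArg _ (hS _ h _)

theorem exists_hasPeriod (hV : V ≠ ⊤) : ∃ r n, 1 ≤ n ∧ V.HasPeriod r n := by
  obtain ⟨u, v, x, huv, hne⟩ := exists_expo_ne_of_ne_top hV
  wlog hlt : expo u x < expo v x generalizing u v
  · exact this v u (theory_symm huv) hne.symm (by omega)
  obtain ⟨p, q, h⟩ := exists_eval_two huv x
  have hmul : (p + 1) * expo u x + p < (p + 1) * expo v x + q := by nlinarith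
  refine ⟨(p + 1) * expo u x + p, ((p + 1) * expo v x + q) - ((p + 1) * expo u x + p),
    by omega, fun S hS a => ?_⟩
  obtain ⟨c, hc⟩ := exists_coe_eq_pow_succ a p
  have := h S hS c a
  rw [hc, ← pow_mul, ← pow_mul, ← pow_add, ← pow_add] at this
  rw [Nat.add_sub_cancel' hmul.le, this]

theorem eval_period {r n : ℕ} (hn : 1 ≤ n) (hV : V.HasPeriod r n) {u v : SGWord}
    (h : (u, v) ∈ V.theory) (x : ℕ) {S : ComSG} (hS : S ∈ modelsOf V.theory)
    (a b : S.carrier) :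
    (a : WithOne S.carrier) ^ expo u x * b ^ (n * (r + 1)) =
      a ^ expo v x * b ^ (n * (r + 1)) := by
  obtain ⟨p, q, h⟩ := exists_eval_two h x
  obtain ⟨k, hk⟩ : ∃ k, n * (r + 1) = k + 1 :=
    ⟨_, (Nat.succ_pred_eq_of_pos (Nat.mul_pos hn r.succ_pos)).symm⟩
  obtain ⟨c, hc⟩ := exists_coe_eq_pow_succ b k
  rw [← hk] at hc
  have hpow : ∀ i : ℕ, (c : WithOne S.carrier) ^ i * c = c := by
    intro i
    rw [← pow_succ, hc, ← pow_mul]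
    refine pow_eq_pow_of_period (hV S hS b) ?_ ?_ ?_
    · nlinarith [Nat.zero_le (n * r * i), Nat.zero_le (n * i), Nat.zero_le (n * r)]
    · nlinarith
    · rw [mul_assoc]
      exact (Nat.modEq_zero_iff_dvd.2 (dvd_mul_right _ _)).trans
        (Nat.modEq_zero_iff_dvd.2 (dvd_mul_right _ _)).symm
  have h2 := congrArg (· * (c : WithOne S.carrier)) (h S hS a c)
  simp only [mul_assoc, hpow] at h2
  rwa [hc] at h2

theorem hasLaw_of_expo_lt {r n : ℕ} (hn : 1 ≤ n) (hV : V.HasPeriod r n) {u v : SGWord}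
    (h : (u, v) ∈ V.theory) {x : ℕ} (hlt : expo u x < expo v x) :
    V.HasLaw n (expo u x) (n * (r + 1)) := by
  intro S hS a b
  have h0 := eval_period hn hV h x hS a b
  obtain ⟨d, hd⟩ := Nat.exists_eq_add_of_lt hlt
  rw [hd] at h0
  generalize expo u x = e at h0
  generalize (b : WithOne S.carrier) ^ (n * (r + 1)) = y at h0
  have key : ∀ k : ℕ, (a : WithOne S.carrier) ^ (e + k * (d + 1)) * y = a ^ e * y := by
    intro k
    induction k with
    | zero => simp
    | succ k ih =>
      rw [show e + (k + 1) * (d + 1) = k * (d + 1) + (e + d + 1) by ring, pow_add, mul_assoc,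
        ← h0, ← mul_assoc, ← pow_add, add_comm _ e, ih]
  rw [← key r, add_comm e n, pow_add, mul_assoc, ← key r, ← mul_assoc, ← pow_add]
  congr 1
  refine pow_eq_pow_of_period (hV S hS a) ?_ ?_ ?_
  · nlinarith [Nat.zero_le (r * d)]
  · nlinarith [Nat.zero_le (r * d)]
  · rw [Nat.ModEq]; simp

theorem HasPeriod.mono {r r' n : ℕ} (h : V.HasPeriod r n) (hr : r ≤ r') : V.HasPeriod r' n :=
  fun S hS a => pow_eq_pow_of_period (h S hS a) (by omega) hr (by rw [Nat.ModEq]; simp)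

/-- `n` is the least eventual period of the variety. -/
def IsLeastPeriod (V : ComVariety) (n : ℕ) : Prop :=
  IsLeast {n | 1 ≤ n ∧ ∃ r, V.HasPeriod r n} n

theorem exists_isLeastPeriod {r n : ℕ} (hn : 1 ≤ n) (h : V.HasPeriod r n) :
    ∃ k, V.IsLeastPeriod k := by
  classical
  have hex : ∃ n, 1 ≤ n ∧ ∃ r, V.HasPeriod r n := ⟨n, hn, r, h⟩
  exact ⟨Nat.find hex, Nat.find_spec hex, fun k hk => Nat.find_min' hex hk⟩

theorem IsLeastPeriod.dvd {n : ℕ} (hn : V.IsLeastPeriod n) {r d : ℕ} (h : V.HasPeriod r d) :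
    n ∣ d := by
  obtain ⟨⟨hn1, r', hr'⟩, hmin⟩ := hn
  by_contra hd
  have hpos : 1 ≤ d % n := Nat.pos_of_ne_zero fun h0 => hd (Nat.dvd_of_mod_eq_zero h0)
  have hlt := Nat.mod_lt d hn1
  refine absurd (hmin ⟨hpos, r + r', fun S hS a => ?_⟩) (by omega)
  rw [← h.mono (Nat.le_add_right r r') S hS a]
  refine pow_eq_pow_of_period (hr' S hS a) (by omega) (by omega) ?_
  exact Nat.ModEq.add_left _ (Nat.mod_modEq d n)

theorem IsLeastPeriod.expo_modEq {n : ℕ} (hn : V.IsLeastPeriod n) {u v : SGWord}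
    (h : (u, v) ∈ V.theory) (x : ℕ) : expo u x ≡ expo v x [MOD n] := by
  wlog hle : expo u x ≤ expo v x generalizing u v
  · exact (this (theory_symm h) (by omega)).symm
  obtain ⟨hn1, r, hr⟩ := hn.1
  refine (Nat.modEq_iff_dvd' hle).2 (hn.dvd (r := expo u x + n * (r + 1)) fun S hS a => ?_)
  have := eval_period hn1 hr h x hS a a
  rw [← pow_add, ← pow_add] at this
  rw [this]
  congr 1
  omega

/-! ### The varieties of the monoids `⟨a ∣ aᵐ = aᵐ⁺¹⟩` and of cyclic groups -/

/-- The cyclic monoid `⟨a ∣ aᵐ = aᵐ⁺¹⟩`, written additively as `{0, …, m}`. -/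
def CycMon (m : ℕ) : Type := {k : ℕ // k ≤ m}

instance (m : ℕ) : CommMonoid (CycMon m) where
  one := ⟨0, Nat.zero_le m⟩
  mul a b := ⟨min (a.1 + b.1) m, min_le_right _ _⟩
  mul_assoc a b c := Subtype.ext (by
    change min (min (a.1 + b.1) m + c.1) m = min (a.1 + min (b.1 + c.1) m) m
    omega)
  one_mul a := Subtype.ext (by
    have := a.2
    change min (0 + a.1) m = a.1
    omega)
  mul_one a := Subtype.ext (by
    have := a.2
    change min (a.1 + 0) m = a.1
    omega)
  mul_comm a b := Subtype.ext (by
    change min (a.1 + b.1) m = min (b.1 + a.1) m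
    omega)

theorem CycMon.pow_val {m : ℕ} (g : CycMon m) (e : ℕ) : (g ^ e).1 = min (e * g.1) m := by
  induction e with
  | zero =>
    rw [pow_zero]
    change 0 = _
    simp
  | succ e ih =>
    rw [pow_succ]
    change min ((g ^ e).1 + g.1) m = _
    rw [ih, add_mul]
    omega

/-- The variety generated by the cyclic monoid `⟨a ∣ aᵐ = aᵐ⁺¹⟩`. -/
def cyc (m : ℕ) : ComVariety := gen (CycMon m)

/-- The variety generated by the cyclic group of order `n`. -/
def grp (n : ℕ) : ComVariety := gen (Multiplicative (ZMod n))

theorem mem_cyc_theory_iff {m : ℕ} {u v : SGWord} :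
    (u, v) ∈ (cyc m).theory ↔ ∀ x, min (expo u x) m = min (expo v x) m := by
  rw [cyc, mem_gen_theory_iff]
  refine forall_congr' fun x => ⟨fun h => ?_, fun h g => Subtype.ext ?_⟩
  · rcases Nat.eq_zero_or_pos m with rfl | hm
    · simp
    · obtain ⟨g, hg⟩ : ∃ g : CycMon m, g.1 = 1 := ⟨⟨1, hm⟩, rfl⟩
      have := congrArg (fun g : CycMon m => g.1) (h g)
      simpa only [CycMon.pow_val, hg, mul_one] using this
  · rw [CycMon.pow_val, CycMon.pow_val]
    rcases le_or_gt m (expo u x) with hu | hu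
    · have hv : m ≤ expo v x := by omega
      rcases Nat.eq_zero_or_pos g.1 with h0 | h0
      · simp [h0]
      · rw [min_eq_right (by nlinarith), min_eq_right (by nlinarith)]
    · rw [show expo u x = expo v x by omega]

theorem mem_grp_theory_iff {n : ℕ} {u v : SGWord} :
    (u, v) ∈ (grp n).theory ↔ ∀ x, expo u x ≡ expo v x [MOD n] := by
  rw [grp, mem_gen_theory_iff]
  refine forall_congr' fun x => ⟨fun h => ?_, fun h g => ?_⟩
  · have := congrArg Multiplicative.toAdd (h (Multiplicative.ofAdd 1))
    rw [toAdd_pow, toAdd_pow, toAdd_ofAdd, nsmul_one, nsmul_one] at this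
    exact (ZMod.natCast_eq_natCast_iff _ _ _).1 this
  · apply Multiplicative.toAdd.injective
    rw [toAdd_pow, toAdd_pow, nsmul_eq_mul, nsmul_eq_mul,
      (ZMod.natCast_eq_natCast_iff _ _ _).2 h]

theorem grp_le_of_isLeastPeriod {n : ℕ} (hn : V.IsLeastPeriod n) : grp n ≤ V :=
  fun _ hi => mem_grp_theory_iff.2 (hn.expo_modEq hi)

theorem exists_hasLaw_of_not_cyc_le {r n m : ℕ} (hn : 1 ≤ n) (hV : V.HasPeriod r n)
    (h : ¬ cyc m ≤ V) : ∃ e < m, V.HasLaw n e (n * (r + 1)) := by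
  obtain ⟨⟨u, v⟩, huv, hne⟩ := Set.not_subset.1 h
  rw [mem_cyc_theory_iff] at hne
  push Not at hne
  obtain ⟨x, hx⟩ := hne
  wlog hlt : expo u x < expo v x generalizing u v
  · exact this v u (theory_symm huv) hx.symm (by omega)
  exact ⟨expo u x, by omega, hasLaw_of_expo_lt hn hV huv hlt⟩

theorem cyc_mono {j k : ℕ} (h : j ≤ k) : cyc j ≤ cyc k := fun _ hi =>
  mem_cyc_theory_iff.2 fun x => by have := mem_cyc_theory_iff.1 hi x; omega

theorem pow_mem_cyc_theory (k : ℕ) :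
    (wpow (ltr 0) (k + 1), wpow (ltr 0) (k + 1 + 1)) ∈ (cyc (k + 1)).theory := by
  refine mem_cyc_theory_iff.2 fun x => ?_
  rw [expo_wpow_succ, expo_wpow_succ, expo_ltr]
  rcases eq_or_ne 0 x with rfl | hx
  · simp
  · simp [hx]

theorem cyc_le_cyc_iff {j k : ℕ} : cyc j ≤ cyc k ↔ j ≤ k := by
  refine ⟨fun h => ?_, cyc_mono⟩
  rcases k with _ | k
  · have h0 : (ltr 0, ltr 1) ∈ (cyc 0).theory := mem_cyc_theory_iff.2 (by simp)
    have := mem_cyc_theory_iff.1 (h h0) 0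
    simp only [expo_ltr, Finsupp.single_apply] at this
    simp at this
    omega
  · have := mem_cyc_theory_iff.1 (h (pow_mem_cyc_theory k)) 0
    simp only [expo_wpow_succ, expo_ltr, Finsupp.smul_apply, Finsupp.single_eq_same, smul_eq_mul,
      mul_one] at this
    omega

theorem cyc_ne_top (m : ℕ) : cyc m ≠ ⊤ := fun h =>
  absurd (cyc_le_cyc_iff.1 (h ▸ le_top : cyc (m + 1) ≤ cyc m)) (by omega)

theorem hasPeriod_cyc (m : ℕ) : (cyc (m + 1)).HasPeriod (m + 1) 1 := by
  intro S hS a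
  have h := congrArg (fun s : S.carrier => (s : WithOne S.carrier))
    (hS _ (pow_mem_cyc_theory m) fun _ => a)
  simp only [coe_lift, lift_wpow_succ] at h
  simpa [ltr] using h.symm

theorem HasPeriod.anti {r n : ℕ} (h : V.HasPeriod r n) (hW : W ≤ V) : W.HasPeriod r n :=
  fun S hS => h S (modelsOf_antitone hW hS)

/-- The word `x ^ e * y ^ (k + 1)` in the letters `x = 0` and `y = 1`. -/
def powMulPow (e k : ℕ) : SGWord := (ltr 0 * ·)^[e] (wpow (ltr 1) (k + 1))

theorem expo_powMulPow (e k : ℕ) : expo (powMulPow e k) 0 = e := by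
  induction e with
  | zero => simp [powMulPow, expo_wpow_succ, expo_ltr]
  | succ e ih =>
    rw [powMulPow, Function.iterate_succ_apply', expo_mul, Finsupp.add_apply, ← powMulPow, ih,
      expo_ltr, Finsupp.single_eq_same, add_comm]

theorem lift_powMulPow {M : Type*} [CommMonoid M] (g : ℕ → M) (e k : ℕ) :
    FreeSemigroup.lift g (powMulPow e k) = g 0 ^ e * g 1 ^ (k + 1) := by
  induction e with
  | zero => simp [powMulPow, lift_wpow_succ, ltr]
  | succ e ih =>
    rw [powMulPow, Function.iterate_succ_apply', map_mul, ← powMulPow, ih,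
      pow_succ' (g 0) e, mul_assoc]
    simp [ltr]

theorem HasLaw.powMulPow_mem {e k : ℕ} (h : V.HasLaw 1 e (k + 1)) :
    (powMulPow (e + 1) k, powMulPow e k) ∈ V.theory := by
  refine mem_theory_iff.2 fun S hS f => WithOne.coe_inj.1 ?_
  rw [coe_lift, coe_lift, lift_powMulPow, lift_powMulPow]
  exact h S hS _ _

theorem cyc_supPrime {m : ℕ} (hm : 1 ≤ m) {A B : ComVariety} (h : cyc m = A ⊔ B) :
    cyc m = A ∨ cyc m = B := by
  obtain ⟨m, rfl⟩ := Nat.exists_eq_add_of_le' hm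
  have hA : A ≤ cyc (m + 1) := h ▸ le_sup_left
  have hB : B ≤ cyc (m + 1) := h ▸ le_sup_right
  by_contra! hne
  have key : ∀ W : ComVariety, W ≤ cyc (m + 1) → cyc (m + 1) ≠ W →
      (powMulPow (m + 1) (m + 1), powMulPow m (m + 1)) ∈ W.theory := by
    intro W hW hWne
    obtain ⟨e, he, hlaw⟩ := exists_hasLaw_of_not_cyc_le le_rfl ((hasPeriod_cyc m).anti hW)
      fun hle => hWne (le_antisymm hle hW)
    exact (hlaw.mono (by omega : e ≤ m) (by omega : _ ≤ m + 1 + 1)).powMulPow_mem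
  have hmem := mem_sup_theory (key A hA hne.1) (key B hB hne.2)
  rw [← h] at hmem
  have := mem_cyc_theory_iff.1 hmem 0
  rw [expo_powMulPow, expo_powMulPow] at this
  omega

/-! ### Decomposition of a periodic variety -/

/-- The words `u` such that `V` satisfies `w ^ n * u = u` for some word `w`. -/
def regularIdeal (V : ComVariety) (n : ℕ) : Set SGWord :=
  {u | ∃ w : SGWord, ∀ S ∈ modelsOf V.theory, ∀ f : ℕ → S.carrier,
    (FreeSemigroup.lift f w : WithOne S.carrier) ^ n * FreeSemigroup.lift f u =
      FreeSemigroup.lift f u}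

theorem mul_mem_regularIdeal {n : ℕ} {u : SGWord} (h : u ∈ V.regularIdeal n) (z : SGWord) :
    u * z ∈ V.regularIdeal n := by
  obtain ⟨w, hw⟩ := h
  refine ⟨w, fun S hS f => ?_⟩
  rw [map_mul, WithOne.coe_mul, ← mul_assoc, hw S hS]

theorem mul_mem_regularIdeal_left {n : ℕ} {u : SGWord} (h : u ∈ V.regularIdeal n) (z : SGWord) :
    z * u ∈ V.regularIdeal n := by
  obtain ⟨w, hw⟩ := h
  refine ⟨w, fun S hS f => ?_⟩
  rw [map_mul, WithOne.coe_mul, mul_left_comm, hw S hS]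

theorem mem_regularIdeal_of_theory {n : ℕ} {u v : SGWord} (h : u ∈ V.regularIdeal n)
    (huv : (u, v) ∈ V.theory) : v ∈ V.regularIdeal n := by
  obtain ⟨w, hw⟩ := h
  refine ⟨w, fun S hS f => ?_⟩
  have huv' : FreeSemigroup.lift f u = FreeSemigroup.lift f v := hS _ huv f
  rw [← huv', hw S hS]

theorem lift_mem_theory {u v : SGWord} (h : (u, v) ∈ V.theory) (σ : ℕ → SGWord) :
    (FreeSemigroup.lift σ u, FreeSemigroup.lift σ v) ∈ V.theory :=
  mem_theory_iff.2 fun S hS f => by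
    rw [lift_lift, lift_lift]
    exact hS _ h _

/-- The Rees congruence of the ideal `regularIdeal V n` on the free semigroup of `V`. -/
def reesCon (V : ComVariety) (n : ℕ) : Con SGWord where
  r u v := (u, v) ∈ V.theory ∨ u ∈ V.regularIdeal n ∧ v ∈ V.regularIdeal n
  iseqv :=
    { refl := fun u => Or.inl (mem_theory_iff.2 fun _ _ _ => rfl)
      symm := by
        rintro u v (h | h)
        exacts [Or.inl (theory_symm h), Or.inr h.symm]
      trans := by
        rintro u v w (h | h) (h' | h')
        · exact Or.inl (mem_theory_iff.2 fun S hS f => (hS _ h f).trans (hS _ h' f))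
        · exact Or.inr ⟨mem_regularIdeal_of_theory h'.1 (theory_symm h), h'.2⟩
        · exact Or.inr ⟨h.1, mem_regularIdeal_of_theory h.2 h'⟩
        · exact Or.inr ⟨h.1, h'.2⟩ }
  mul' := by
    rintro u v w z (h | h) (h' | h')
    · refine Or.inl (mem_theory_iff.2 fun S hS f => ?_)
      change FreeSemigroup.lift f (u * w) = FreeSemigroup.lift f (v * z)
      rw [map_mul, map_mul]
      exact congrArg₂ _ (hS _ h f) (hS _ h' f)
    · exact Or.inr ⟨mul_mem_regularIdeal_left h'.1 _, mul_mem_regularIdeal_left h'.2 _⟩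
    · exact Or.inr ⟨mul_mem_regularIdeal h.1 _, mul_mem_regularIdeal h.2 _⟩
    · exact Or.inr ⟨mul_mem_regularIdeal h.1 _, mul_mem_regularIdeal h.2 _⟩

instance (V : ComVariety) (n : ℕ) : CommSemigroup (V.reesCon n).Quotient where
  mul_comm a b := Con.induction_on₂ a b fun u v => (Con.eq _).2 <| Or.inl <|
    mem_theory_iff.2 fun S _ f => by
      change FreeSemigroup.lift f (u * v) = FreeSemigroup.lift f (v * u)
      rw [map_mul, map_mul, mul_comm]

instance (V : ComVariety) (n : ℕ) : Nonempty (V.reesCon n).Quotient :=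
  ⟨((ltr 0 : SGWord) : (V.reesCon n).Quotient)⟩

theorem lift_coe_quotient (V : ComVariety) (n : ℕ) (σ : ℕ → SGWord) (u : SGWord) :
    FreeSemigroup.lift (fun k => ((σ k : SGWord) : (V.reesCon n).Quotient)) u =
      ((FreeSemigroup.lift σ u : SGWord) : (V.reesCon n).Quotient) := by
  induction u using FreeSemigroup.recOnMul with
  | ih1 y => simp
  | ih2 y z hy hz => rw [map_mul, map_mul, Con.coe_mul, hy, hz]

/-- The variety generated by the Rees quotient of the free semigroup of `V`. -/
def nilPart (V : ComVariety) (n : ℕ) : ComVariety := gen (V.reesCon n).Quotient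

theorem mem_nilPart_theory_iff {n : ℕ} {u v : SGWord} : (u, v) ∈ (V.nilPart n).theory ↔
    ∀ σ : ℕ → SGWord, V.reesCon n (FreeSemigroup.lift σ u) (FreeSemigroup.lift σ v) := by
  refine ⟨fun h σ => (Con.eq _).1 ?_, fun h f => ?_⟩
  · rw [← lift_coe_quotient, ← lift_coe_quotient]
    exact h _
  · obtain ⟨σ, hσ⟩ : ∃ σ : ℕ → SGWord, f = fun k => ((σ k : SGWord) : (V.reesCon n).Quotient) :=
      ⟨fun k => (f k).out, funext fun k => (Quotient.out_eq (f k)).symm⟩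
    rw [hσ]
    exact ((lift_coe_quotient V n σ u).trans ((Con.eq _).2 (h σ))).trans
      (lift_coe_quotient V n σ v).symm

theorem nilPart_le (n : ℕ) : V.nilPart n ≤ V := fun _ hi =>
  mem_nilPart_theory_iff.2 fun σ => Or.inl (lift_mem_theory hi σ)

theorem lift_ltr (u : SGWord) : FreeSemigroup.lift ltr u = u :=
  DFunLike.congr_fun (FreeSemigroup.lift_comp_of' (MulHom.id SGWord)) u

theorem lift_wpow (σ : ℕ → SGWord) (w : SGWord) (k : ℕ) :
    FreeSemigroup.lift σ (wpow w (k + 1)) = wpow (FreeSemigroup.lift σ w) (k + 1) := by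
  induction k with
  | zero => rfl
  | succ k ih => rw [wpow, map_mul, ih, wpow]

theorem not_cyc_le_nilPart {r n : ℕ} (hV : V.HasPeriod r n) (k : ℕ) :
    ¬ cyc 1 ≤ V.nilPart (n * k) := by
  intro h
  have hreg : ∀ w : SGWord, wpow w (r + 1) ∈ V.regularIdeal (n * k) := by
    refine fun w => ⟨w, fun S hS f => ?_⟩
    rw [coe_lift, coe_lift, lift_wpow_succ, ← coe_lift, ← pow_add]
    refine pow_eq_pow_of_period (hV S hS _) (by omega) (by omega) ?_
    rw [Nat.ModEq]
    simp
  have hmem : (wpow (ltr 0) (r + 1) * ltr 1, wpow (ltr 0) (r + 1)) ∈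
      (V.nilPart (n * k)).theory := by
    refine mem_nilPart_theory_iff.2 fun σ => Or.inr ?_
    rw [map_mul, lift_wpow]
    exact ⟨mul_mem_regularIdeal (hreg _) _, hreg _⟩
  have := mem_cyc_theory_iff.1 (h hmem) 1
  simp [expo_mul, expo_wpow_succ, expo_ltr] at this

theorem eq_sup {r n : ℕ} (hV : V.HasPeriod r n) (hn : V.IsLeastPeriod n) :
    ∃ m, V = grp n ⊔ cyc m ⊔ V.nilPart (n * (r + 1)) := by
  classical
  have hn1 : 1 ≤ n := hn.1.1
  have hex : ∃ m k, V.HasLaw n m k := ⟨r, 0, fun S hS a b => by rw [hV S hS]⟩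
  obtain ⟨k, hk⟩ := Nat.find_spec hex
  have hmin : ∀ e k, V.HasLaw n e k → Nat.find hex ≤ e := fun e k h => Nat.find_min' hex ⟨k, h⟩
  generalize Nat.find hex = m at hk hmin
  have hcyc : cyc m ≤ V := by
    by_contra h
    obtain ⟨e, he, hlaw⟩ := exists_hasLaw_of_not_cyc_le hn1 hV h
    exact absurd (hmin e _ hlaw) (by omega)
  have hgrp : grp n ≤ V := grp_le_of_isLeastPeriod hn
  refine ⟨m, le_antisymm ?_ (sup_le (sup_le hgrp hcyc) (nilPart_le _))⟩
  rintro ⟨u, v⟩ huv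
  have hg := mem_grp_theory_iff.1 ((le_sup_left.trans le_sup_left : grp n ≤ _) huv)
  have hc := mem_cyc_theory_iff.1 ((le_sup_right.trans le_sup_left : cyc m ≤ _) huv)
  have hN := mem_nilPart_theory_iff.1 ((le_sup_right : V.nilPart (n * (r + 1)) ≤ _) huv) ltr
  rw [lift_ltr, lift_ltr] at hN
  rcases hN with h | ⟨hu, hv⟩
  · exact h
  refine mem_theory_iff.2 fun S hS f => WithOne.coe_inj.1 ?_
  set F := (expo u).support ∪ (expo v).support
  set ω := n * (r + 1) with hω
  have hωr : r ≤ ω := by nlinarith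
  have absorb : ∀ w ∈ V.regularIdeal ω, ∀ x ∈ F, m ≤ expo w x →
      (f x : WithOne S.carrier) ^ ω * FreeSemigroup.lift f w = FreeSemigroup.lift f w := by
    rintro w ⟨a, ha⟩ x hxF hx
    have hA : ∀ j : ℕ, (FreeSemigroup.lift f a : WithOne S.carrier) ^ (ω * j) *
        FreeSemigroup.lift f w = FreeSemigroup.lift f w := by
      intro j
      induction j with
      | zero => simp
      | succ j ih => rw [mul_add, mul_one, pow_add, mul_assoc, ha S hS f, ih]
    obtain ⟨rest, hrest⟩ : ∃ y, (FreeSemigroup.lift f w : WithOne S.carrier) = f x ^ m * y := by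
      refine ⟨f x ^ (expo w x - m) * ∏ z ∈ (F ∪ (expo w).support).erase x,
        (f z : WithOne S.carrier) ^ expo w z, ?_⟩
      rw [coe_lift, lift_eq_prod_of_subset _ w Finset.subset_union_right,
        ← Finset.mul_prod_erase _ _ (Finset.mem_union_left _ hxF), ← mul_assoc, ← pow_add,
        Nat.add_sub_cancel' hx]
    have hper : ∀ j : ℕ, (f x : WithOne S.carrier) ^ (m + n * j) *
        FreeSemigroup.lift f a ^ (ω * k) = f x ^ m * FreeSemigroup.lift f a ^ (ω * k) := by
      intro j
      induction j with
      | zero => simp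
      | succ j ih =>
        rw [mul_add, mul_one, ← add_assoc, ← ih]
        exact hk.mono (Nat.le_add_right _ _) (Nat.le_mul_of_pos_left k (by positivity)) S hS _ _
    calc (f x : WithOne S.carrier) ^ ω * FreeSemigroup.lift f w
        = f x ^ (m + ω) * FreeSemigroup.lift f a ^ (ω * k) * rest := by
          rw [← hA k, hrest, pow_add]
          ac_rfl
      _ = FreeSemigroup.lift f w := by
          rw [hper, ← hA k, hrest]
          ac_rfl
  have absorb_prod : ∀ w ∈ V.regularIdeal ω, (∀ x, m ≤ expo w x ↔ m ≤ expo u x) →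
      (∏ x ∈ F, if m ≤ expo u x then (f x : WithOne S.carrier) ^ ω else 1) *
        FreeSemigroup.lift f w = FreeSemigroup.lift f w := by
    intro w hw hwu
    have : ∀ G ⊆ F, (∏ x ∈ G, if m ≤ expo u x then (f x : WithOne S.carrier) ^ ω else 1) *
        FreeSemigroup.lift f w = FreeSemigroup.lift f w := by
      intro G
      induction G using Finset.induction_on with
      | empty => simp
      | insert x G hxG ih =>
        intro hG
        rw [Finset.prod_insert hxG, mul_assoc, ih ((Finset.subset_insert _ _).trans hG)]
        split_ifs with h
        · exact absorb w hw x (hG (Finset.mem_insert_self _ _)) ((hwu x).2 h)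
        · exact one_mul _
    exact this F subset_rfl
  rw [← absorb_prod u hu fun _ => Iff.rfl,
    ← absorb_prod v hv fun x => by have := hc x; omega, coe_lift, coe_lift,
    lift_eq_prod_of_subset _ u Finset.subset_union_left,
    lift_eq_prod_of_subset _ v Finset.subset_union_right, ← Finset.prod_mul_distrib,
    ← Finset.prod_mul_distrib]
  refine Finset.prod_congr rfl fun x _ => ?_
  split_ifs with h
  · rw [← pow_add, ← pow_add]
    exact pow_eq_pow_of_period (hV S hS _) (by omega) (by omega) ((hg x).add_left _)
  · rw [show expo u x = expo v x by have := hc x; omega]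

theorem not_cyc_le_grp {n : ℕ} (hn : 1 ≤ n) : ¬ cyc 1 ≤ grp n := by
  intro h
  obtain ⟨k, rfl⟩ := Nat.exists_eq_add_of_le' hn
  have hmem : (wpow (ltr 0) (k + 1) * ltr 1, ltr 1) ∈ (grp (k + 1)).theory := by
    refine mem_grp_theory_iff.2 fun x => ?_
    rw [expo_mul, expo_wpow_succ, Finsupp.add_apply, Finsupp.smul_apply, smul_eq_mul, Nat.ModEq]
    simp
  have := mem_cyc_theory_iff.1 (h hmem) 0
  simp [expo_mul, expo_wpow_succ, expo_ltr] at this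

theorem exists_eq_cyc (htop : V ≠ ⊤) (hirr : ∀ A B, V = A ⊔ B → V = A ∨ V = B)
    (h1 : cyc 1 ≤ V) : ∃ m, 1 ≤ m ∧ V = cyc m := by
  obtain ⟨r, n, hn, hV⟩ := exists_hasPeriod htop
  obtain ⟨n, hn⟩ := exists_isLeastPeriod hn hV
  obtain ⟨-, r, hV⟩ := hn.1
  obtain ⟨m, hm⟩ := eq_sup hV hn
  rcases hirr _ _ hm with h | h
  · rcases hirr _ _ h with h | h
    · exact absurd (h ▸ h1) (not_cyc_le_grp hn.1.1)
    · exact ⟨m, cyc_le_cyc_iff.1 (h ▸ h1), h⟩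
  · exact absurd (h1.trans h.le) (not_cyc_le_nilPart hV _)

/-! ### The varieties `Dvar m` -/

theorem mem_modelsOf_Dvar {m : ℕ} {S : ComSG} :
    S ∈ modelsOf (Dvar (m + 1)).theory ↔
      ∀ a b : S.carrier, (a : WithOne S.carrier) ^ (m + 1) * b = a ^ (m + 1) := by
  have hmod : S ∈ modelsOf (Dvar (m + 1)).theory ↔
      S ∈ modelsOf ({commId} ∪ zeroId (wpow (ltr 0) (m + 1)) 1) :=
    ⟨fun h i hi => h i (subset_theoryOfClass_modelsOf _ hi), fun h i hi => hi S h⟩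
  rw [hmod]
  constructor
  · intro h a b
    have h0 : FreeSemigroup.lift _ _ = FreeSemigroup.lift _ _ :=
      h (wpow (ltr 0) (m + 1) * ltr 1, wpow (ltr 0) (m + 1)) (by simp [zeroId])
        fun n => if n = 0 then a else b
    have := congrArg (fun s : S.carrier => (s : WithOne S.carrier)) h0
    rw [coe_lift_ite, coe_lift_ite, map_mul, lift_wpow_succ] at this
    simpa [ltr] using this
  · intro h i hi f
    refine WithOne.coe_inj.1 ?_
    rcases hi with rfl | rfl | rfl
    · rw [coe_lift, coe_lift, commId, map_mul, map_mul, mul_comm]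
    · rw [coe_lift, coe_lift, map_mul, lift_wpow_succ]
      exact h _ _
    · rw [coe_lift, coe_lift, map_mul, mul_comm, lift_wpow_succ]
      exact h _ _

theorem Dvar_le_cyc {m : ℕ} : Dvar (m + 1) ≤ cyc (m + 1) := by
  rintro ⟨u, v⟩ huv
  rw [mem_cyc_theory_iff] at huv
  refine mem_theory_iff.2 fun S hS f => WithOne.coe_inj.1 ?_
  rw [mem_modelsOf_Dvar] at hS
  by_cases hne : ∀ x, expo u x = expo v x
  · rw [coe_lift, coe_lift]
    exact lift_congr _ fun x => by rw [hne]
  push Not at hne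
  obtain ⟨x, hx⟩ := hne
  have key : ∀ w : SGWord, m + 1 ≤ expo w x →
      (FreeSemigroup.lift f w : WithOne S.carrier) = f x ^ (m + 1) := by
    intro w hw
    obtain ⟨y, hy⟩ : ∃ y, (FreeSemigroup.lift f w : WithOne S.carrier) = f x ^ (m + 1) * y := by
      refine ⟨f x ^ (expo w x - (m + 1)) * ∏ z ∈ (expo w).support.erase x,
        (f z : WithOne S.carrier) ^ expo w z, ?_⟩
      rw [coe_lift, lift_eq_prod_of_subset _ w subset_rfl,
        ← Finset.mul_prod_erase _ _ (Finsupp.mem_support_iff.2 (by omega : expo w x ≠ 0)),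
        ← mul_assoc, ← pow_add, Nat.add_sub_cancel' hw]
    rw [hy]
    induction y using WithOne.recOneCoe with
    | one => exact mul_one _
    | coe y => exact hS _ _
  have := huv x
  rw [key u (by omega), key v (by omega)]

theorem not_cyc_le_Dvar {m : ℕ} : ¬ cyc 1 ≤ Dvar (m + 1) := by
  intro h
  have hmem : (wpow (ltr 0) (m + 1) * ltr 1, wpow (ltr 0) (m + 1)) ∈ (Dvar (m + 1)).theory :=
    subset_theoryOfClass_modelsOf _ (by simp [zeroId])
  have := mem_cyc_theory_iff.1 (h hmem) 1
  simp [expo_mul, expo_wpow_succ, expo_ltr] at this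

theorem le_Dvar {m : ℕ} (hV : V ≤ cyc (m + 1)) (h1 : ¬ cyc 1 ≤ V) : V ≤ Dvar (m + 1) := by
  have hper := (hasPeriod_cyc m).anti hV
  obtain ⟨e, he, hlaw⟩ := exists_hasLaw_of_not_cyc_le le_rfl hper h1
  obtain rfl : e = 0 := by omega
  refine le_of_models fun S hS => mem_modelsOf_Dvar.2 fun a b => ?_
  have := hlaw S hS b a
  rw [pow_zero, one_mul, zero_add, pow_one, one_mul] at this
  rwa [pow_eq_pow_of_period (hper S hS a) (by omega) le_rfl (Nat.modEq_one), mul_comm] at this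

/-! ### The variety of semilattices -/

theorem grp_le_grp_iff {a b : ℕ} (hb : 1 ≤ b) : grp a ≤ grp b ↔ a ∣ b := by
  refine ⟨fun h => ?_, fun h i hi => ?_⟩
  · obtain ⟨b, rfl⟩ := Nat.exists_eq_add_of_le' hb
    have hmem : (wpow (ltr 0) (b + 1 + 1), ltr 0) ∈ (grp (b + 1)).theory := by
      refine mem_grp_theory_iff.2 fun x => ?_
      rw [expo_wpow_succ, Finsupp.smul_apply, smul_eq_mul, add_mul (b + 1), one_mul, Nat.ModEq]
      simp
    have := mem_grp_theory_iff.1 (h hmem) 0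
    rw [expo_wpow_succ, expo_ltr] at this
    have h2 := (Nat.modEq_iff_dvd' (by simp)).1 this.symm
    simpa using h2
  · exact mem_grp_theory_iff.2 fun x => (mem_grp_theory_iff.1 hi x).of_dvd h

/-- The semigroup `⟨a ∣ a ^ (n + 1) = 0⟩`, written additively as `{1, …, n + 1}`. -/
def NilCyc (n : ℕ) : Type := {k : ℕ // 1 ≤ k ∧ k ≤ n + 1}

instance (n : ℕ) : CommSemigroup (NilCyc n) where
  mul a b := ⟨min (a.1 + b.1) (n + 1), by have := a.2; omega⟩
  mul_assoc a b c := Subtype.ext (by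
    change min (min (a.1 + b.1) (n + 1) + c.1) (n + 1) =
      min (a.1 + min (b.1 + c.1) (n + 1)) (n + 1)
    omega)
  mul_comm a b := Subtype.ext (by
    change min (a.1 + b.1) (n + 1) = min (b.1 + a.1) (n + 1)
    omega)

/-- The generator `a` of `⟨a ∣ a ^ (n + 1) = 0⟩`. -/
def NilCyc.root (n : ℕ) : NilCyc n := ⟨1, by omega⟩

theorem NilCyc.root_val (n : ℕ) : (NilCyc.root n).1 = 1 := rfl

instance (n : ℕ) : Nonempty (NilCyc n) := ⟨NilCyc.root n⟩

theorem NilCyc.mul_val {n : ℕ} (a b : NilCyc n) : (a * b).1 = min (a.1 + b.1) (n + 1) := rfl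

/-- The variety generated by the semigroup `⟨a ∣ a ^ (n + 1) = 0⟩`. -/
def nil (n : ℕ) : ComVariety := gen (NilCyc n)

theorem cube_mul_mem_nil_theory {n : ℕ} (hn : n ≤ 2) :
    (ltr 0 * ltr 0 * ltr 0 * ltr 1, ltr 0 * ltr 0 * ltr 0) ∈ (nil n).theory := by
  refine fun f => Subtype.ext ?_
  simp only [map_mul, NilCyc.mul_val, ltr, FreeSemigroup.lift_of]
  have h0 := (f 0).2
  have h1 := (f 1).2
  omega

theorem not_cyc_le_nil {n : ℕ} (hn : n ≤ 2) : ¬ cyc 1 ≤ nil n := by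
  intro h
  have := mem_cyc_theory_iff.1 (h (cube_mul_mem_nil_theory hn)) 1
  simp [expo_mul, expo_ltr] at this

theorem not_grp_le_nil {n p : ℕ} (hn : n ≤ 2) (hp : p ≠ 1) : ¬ grp p ≤ nil n := by
  intro h
  have := mem_grp_theory_iff.1 (h (cube_mul_mem_nil_theory hn)) 1
  simp only [expo_mul, expo_ltr, Finsupp.add_apply] at this
  simp [Nat.modEq_zero_iff_dvd, hp] at this

theorem not_nil_le_grp {n m : ℕ} (hn : 1 ≤ n) (hm : 1 ≤ m) : ¬ nil n ≤ grp m := by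
  intro h
  obtain ⟨m, rfl⟩ := Nat.exists_eq_add_of_le' hm
  have hmem : (wpow (ltr 0) (m + 1) * ltr 0, ltr 0) ∈ (grp (m + 1)).theory := by
    refine mem_grp_theory_iff.2 fun x => ?_
    rw [expo_mul, expo_wpow_succ, Finsupp.add_apply, Finsupp.smul_apply, smul_eq_mul, Nat.ModEq]
    simp
  have := congrArg (fun a : NilCyc n => a.1) (h hmem fun _ => NilCyc.root n)
  simp only [map_mul, NilCyc.mul_val, ltr, FreeSemigroup.lift_of] at this
  have := (FreeSemigroup.lift (fun _ => NilCyc.root n) (wpow (FreeSemigroup.of 0) (m + 1))).2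
  have := NilCyc.root_val n
  omega

theorem mul_mem_nil_theory (u v w z : SGWord) : (u * v, w * z) ∈ (nil 1).theory := by
  refine fun f => Subtype.ext ?_
  simp only [map_mul, NilCyc.mul_val]
  have := (FreeSemigroup.lift f u).2
  have := (FreeSemigroup.lift f v).2
  have := (FreeSemigroup.lift f w).2
  have := (FreeSemigroup.lift f z).2
  omega

theorem not_nil_two_le_nil_one : ¬ nil 2 ≤ nil 1 := by
  intro h
  have := congrArg (fun a : NilCyc 2 => a.1)
    (h (mul_mem_nil_theory (ltr 0) (ltr 0) (ltr 0 * ltr 0) (ltr 0)) fun _ => NilCyc.root 2)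
  simp [NilCyc.mul_val, ltr, NilCyc.root_val] at this

theorem eq_ltr_or_eq_mul (u : SGWord) : (∃ x, u = ltr x) ∨ ∃ w z, u = w * z := by
  induction u using FreeSemigroup.recOnMul with
  | ih1 x => exact Or.inl ⟨x, rfl⟩
  | ih2 x y _ _ => exact Or.inr ⟨_, _, rfl⟩

theorem exists_lift_const (u : SGWord) :
    ∃ k, ∀ (M : Type) [CommMonoid M] (a : M), FreeSemigroup.lift (fun _ => a) u = a ^ (k + 1) := by
  induction u using FreeSemigroup.recOnMul with
  | ih1 x => exact ⟨0, fun M _ a => by simp⟩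
  | ih2 x y hx hy =>
    obtain ⟨i, hi⟩ := hx
    obtain ⟨j, hj⟩ := hy
    exact ⟨i + j + 1, fun M _ a => by rw [map_mul, hi, hj, ← pow_add]; congr 1; omega⟩

theorem exists_hasPeriod_one_of_mem_theory {x : ℕ} {u : SGWord} (h : (ltr x, u) ∈ V.theory)
    (hu : ltr x ≠ u) : ∃ k, 1 ≤ k ∧ V.HasPeriod 1 k := by
  rcases eq_ltr_or_eq_mul u with ⟨y, rfl⟩ | ⟨w, z, rfl⟩
  · refine ⟨1, le_rfl, fun S hS a => ?_⟩
    have h0 : FreeSemigroup.lift _ _ = FreeSemigroup.lift _ _ :=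
      hS _ h fun n => if n = x then a * a else a
    have hyx : y ≠ x := fun h => hu (h ▸ rfl)
    simp only [ltr, FreeSemigroup.lift_of, if_pos, if_neg hyx] at h0
    rw [pow_add, pow_one, ← WithOne.coe_mul, h0]
  · obtain ⟨i, hi⟩ := exists_lift_const w
    obtain ⟨j, hj⟩ := exists_lift_const z
    refine ⟨i + j + 1, by omega, fun S hS a => ?_⟩
    have h0 : FreeSemigroup.lift _ _ = FreeSemigroup.lift _ _ := hS _ h fun _ => a
    have := congrArg (fun s : S.carrier => (s : WithOne S.carrier)) h0
    rw [coe_lift, coe_lift, map_mul, hi, hj, ← pow_add] at this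
    rw [show 1 + (i + j + 1) = i + 1 + (j + 1) by omega, ← this]
    simp [ltr]

theorem exists_hasPeriod_one (h : ¬ nil 1 ≤ V) : ∃ k, 1 ≤ k ∧ V.HasPeriod 1 k := by
  obtain ⟨⟨u, v⟩, huv, hne⟩ := Set.not_subset.1 h
  have huv' : u ≠ v := fun h => hne (h ▸ fun _ => rfl)
  rcases eq_ltr_or_eq_mul u with ⟨x, rfl⟩ | ⟨a, b, rfl⟩
  · exact exists_hasPeriod_one_of_mem_theory huv huv'
  rcases eq_ltr_or_eq_mul v with ⟨y, rfl⟩ | ⟨c, d, rfl⟩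
  · exact exists_hasPeriod_one_of_mem_theory (theory_symm huv) huv'.symm
  · exact absurd (mul_mem_nil_theory a b c d) hne

/-- Every variety contains the null semigroups, a group of prime order, or only semilattices. -/
theorem nil_le_or_grp_le_or_le_cyc (V : ComVariety) :
    nil 1 ≤ V ∨ (∃ p, p.Prime ∧ grp p ≤ V) ∨ V ≤ cyc 1 := by
  refine or_iff_not_imp_left.2 fun h => ?_
  obtain ⟨k, hk, hV⟩ := exists_hasPeriod_one h
  obtain ⟨n, hn⟩ := exists_isLeastPeriod hk hV
  rcases eq_or_ne n 1 with rfl | hn1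
  · obtain ⟨-, r, hr⟩ := hn.1
    have hidem : V.HasPeriod 1 1 := by
      intro S hS a
      have hper : ∀ i, 1 ≤ i → (a : WithOne S.carrier) ^ i = a ^ (i + k * r) := fun i hi =>
        pow_eq_pow_of_period (hV S hS a) hi (by omega) (by rw [Nat.ModEq]; simp)
      have : r ≤ k * r := Nat.le_mul_of_pos_left r hk
      rw [hper (1 + 1) (by omega), hper 1 le_rfl]
      exact pow_eq_pow_of_period (hr S hS a) (by omega) (by omega) Nat.modEq_one
    refine Or.inr fun ⟨u, v⟩ hi => mem_theory_iff.2 fun S hS f => WithOne.coe_inj.1 ?_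
    rw [coe_lift, coe_lift]
    refine lift_congr _ fun x => ?_
    have := mem_cyc_theory_iff.1 hi x
    rcases Nat.eq_zero_or_pos (expo u x) with h0 | h0
    · rw [h0, show expo v x = 0 by omega]
    · exact pow_eq_pow_of_period (hidem S hS _) h0 (by omega : 1 ≤ expo v x) Nat.modEq_one
  · obtain ⟨p, hp, hpn⟩ := Nat.exists_prime_and_dvd hn1
    exact Or.inl ⟨p, hp, ((grp_le_grp_iff hn.1.1).2 hpn).trans (grp_le_of_isLeastPeriod hn)⟩

theorem eq_bot_of_le_cyc_one (h : V ≤ cyc 1) (h1 : ¬ cyc 1 ≤ V) : V = ⊥ := by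
  have hD : V ≤ Dvar (0 + 1) := le_Dvar h h1
  refine eq_bot_of_subsingleton fun S hS a b => WithOne.coe_inj.1 ?_
  have h := mem_modelsOf_Dvar.1 (modelsOf_antitone hD hS)
  have hab := h a b
  have hba := h b a
  rw [zero_add, pow_one] at hab hba
  rw [← hab, mul_comm, hba]

end ComVariety

section LatticePredicates

variable {L : Type*} [Lattice L]

/-- `s` is a non-least element below all non-least elements below it, and lies above each
element all of whose non-least lower bounds are above `s`.  This singles out the variety of
semilattices in `ComVariety`. -/
def IsDominantAtom (s : L) : Prop :=
  ¬ (∀ x, s ≤ x) ∧ (∀ b, b ≤ s → ¬ (∀ x, b ≤ x) → s ≤ b) ∧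
    ∀ v, (∀ b, b ≤ v → ¬ (∀ x, b ≤ x) → s ≤ b) → v ≤ s

/-- `c` is a join-irreducible non-greatest element above a dominant atom. -/
def IsIrredAboveAtom (c : L) : Prop :=
  (∃ s, IsDominantAtom s ∧ s ≤ c) ∧ ¬ (∀ x, x ≤ c) ∧ ∀ a b, c = a ⊔ b → c = a ∨ c = b

/-- `c` is the `m`-th element of the chain `IsIrredAboveAtom`, counting from zero. -/
def IsNthIrred : ℕ → L → Prop
  | 0, c => IsDominantAtom c
  | m + 1, c => ∃ b, IsNthIrred m b ∧ ¬ c ≤ b ∧ IsIrredAboveAtom c ∧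
      ∀ d, IsIrredAboveAtom d → ¬ d ≤ b → c ≤ d

/-- `d` is the greatest element below the `m`-th irreducible that is not above a dominant
atom. -/
def IsNthNil (m : ℕ) (d : L) : Prop :=
  ∃ c s, IsNthIrred m c ∧ IsDominantAtom s ∧ d ≤ c ∧ ¬ s ≤ d ∧ ∀ e, e ≤ c → ¬ s ≤ e → e ≤ d

end LatticePredicates

namespace ComVariety

variable {V : ComVariety}

theorem not_forall_le_iff : ¬ (∀ W, V ≤ W) ↔ V ≠ ⊥ :=
  not_congr ⟨fun h => le_bot_iff.1 (h ⊥), fun h _ => h ▸ bot_le⟩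

theorem isDominantAtom_iff : IsDominantAtom V ↔ V = cyc 1 := by
  have hgrp1 : ∀ U : ComVariety, ¬ U ≤ grp 1 → U ≠ ⊥ := fun U h h0 => h (h0 ▸ bot_le)
  have hcyc : cyc 1 ≠ ⊥ := hgrp1 _ (not_cyc_le_grp le_rfl)
  have hnil : nil 1 ≠ ⊥ := hgrp1 _ (not_nil_le_grp le_rfl le_rfl)
  have hgrp : ∀ p, p.Prime → grp p ≠ ⊥ := fun p hp =>
    hgrp1 _ fun h => hp.one_lt.ne' (Nat.dvd_one.1 ((grp_le_grp_iff le_rfl).1 h))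
  have hmin : ∀ b ≤ cyc 1, b ≠ ⊥ → cyc 1 ≤ b := fun b hb h0 => by
    by_contra h
    exact h0 (eq_bot_of_le_cyc_one hb h)
  simp only [IsDominantAtom, not_forall_le_iff]
  constructor
  · rintro ⟨hV, hVmin, hVmax⟩
    rcases nil_le_or_grp_le_or_le_cyc V with h | ⟨p, hp, h⟩ | h
    · obtain rfl : V = nil 1 := le_antisymm (hVmin _ h hnil) h
      refine absurd (hVmax (nil 2) fun b hb h0 => ?_) not_nil_two_le_nil_one
      rcases nil_le_or_grp_le_or_le_cyc b with h | ⟨p, hp, h⟩ | h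
      · exact h
      · exact absurd (h.trans hb) (not_grp_le_nil le_rfl hp.ne_one)
      · exact absurd ((hmin b h h0).trans hb) (not_cyc_le_nil le_rfl)
    · obtain rfl : V = grp p := le_antisymm (hVmin _ h (hgrp p hp)) h
      have hp2 : 1 ≤ p ^ 2 := Nat.pow_pos hp.pos
      refine absurd (hVmax (grp (p ^ 2)) fun b hb h0 => ?_) fun h => ?_
      · rcases nil_le_or_grp_le_or_le_cyc b with h | ⟨q, hq, h⟩ | h
        · exact absurd (h.trans hb) (not_nil_le_grp le_rfl hp2)
        · have hqp := hq.dvd_of_dvd_pow ((grp_le_grp_iff hp2).1 (h.trans hb))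
          exact (Nat.prime_dvd_prime_iff_eq hq hp).1 hqp ▸ h
        · exact absurd ((hmin b h h0).trans hb) (not_cyc_le_grp hp2)
      · have := Nat.le_of_dvd hp.pos ((grp_le_grp_iff hp.pos).1 h)
        nlinarith [hp.two_le]
    · exact le_antisymm h (hmin V h hV)
  · rintro rfl
    refine ⟨hcyc, hmin, fun V hV => ?_⟩
    rcases nil_le_or_grp_le_or_le_cyc V with h | ⟨p, hp, h⟩ | h
    · exact absurd (hV _ h hnil) (not_cyc_le_nil one_le_two)
    · exact absurd (hV _ h (hgrp p hp)) (not_cyc_le_grp hp.pos)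
    · exact h

theorem isIrredAboveAtom_iff : IsIrredAboveAtom V ↔ ∃ m, V = cyc (m + 1) := by
  simp only [IsIrredAboveAtom, isDominantAtom_iff, exists_eq_left]
  constructor
  · rintro ⟨h1, htop, hirr⟩
    obtain ⟨m, hm, rfl⟩ := exists_eq_cyc (V := V) (fun h => htop fun _ => h ▸ le_top) hirr h1
    exact ⟨m - 1, by rw [Nat.sub_add_cancel hm]⟩
  · rintro ⟨m, rfl⟩
    exact ⟨cyc_mono (by omega), fun h => cyc_ne_top _ (top_le_iff.1 (h ⊤)),
      fun A B h => cyc_supPrime (by omega) h⟩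

theorem isNthIrred_iff {m : ℕ} : IsNthIrred m V ↔ V = cyc (m + 1) := by
  induction m generalizing V with
  | zero => exact isDominantAtom_iff
  | succ m ih =>
    simp only [IsNthIrred, ih, exists_eq_left, isIrredAboveAtom_iff]
    constructor
    · rintro ⟨hle, ⟨k, rfl⟩, hmin⟩
      rw [cyc_le_cyc_iff] at hle
      refine le_antisymm (hmin _ ⟨m + 1, rfl⟩ ?_) (cyc_mono (by omega))
      rw [cyc_le_cyc_iff]
      omega
    · rintro rfl
      refine ⟨?_, ⟨m + 1, rfl⟩, ?_⟩
      · rw [cyc_le_cyc_iff]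
        omega
      · rintro _ ⟨k, rfl⟩ h
        rw [cyc_le_cyc_iff] at h
        exact cyc_mono (by omega)

theorem isNthNil_iff {m : ℕ} : IsNthNil m V ↔ V = Dvar (m + 1) := by
  simp only [IsNthNil, isNthIrred_iff, isDominantAtom_iff, exists_and_left, exists_eq_left]
  constructor
  · rintro ⟨hV, h1, hmax⟩
    exact le_antisymm (le_Dvar hV h1) (hmax _ Dvar_le_cyc not_cyc_le_Dvar)
  · rintro rfl
    exact ⟨Dvar_le_cyc, not_cyc_le_Dvar, fun e => le_Dvar⟩

end ComVariety

/-! ### First-order definability -/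

/-- A predicate on assignments that is expressed by a formula of the language of lattices. -/
def IsFirstOrder {L : Type*} [Lattice L] {α : Type} (P : (α → L) → Prop) : Prop :=
  ∃ φ : latticeLang.Formula α, ∀ v : α → L, φ.Realize v ↔ P v

namespace IsFirstOrder

variable {L : Type*} [Lattice L] {α : Type} {P Q : (α → L) → Prop}

theorem neg (hP : IsFirstOrder P) : IsFirstOrder fun v => ¬ P v := by
  obtain ⟨φ, hφ⟩ := hP
  exact ⟨φ.not, fun v => by rw [Language.Formula.realize_not, hφ]⟩

theorem and (hP : IsFirstOrder P) (hQ : IsFirstOrder Q) : IsFirstOrder fun v => P v ∧ Q v := by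
  obtain ⟨φ, hφ⟩ := hP
  obtain ⟨ψ, hψ⟩ := hQ
  exact ⟨φ ⊓ ψ, fun v => by rw [Language.Formula.realize_inf, hφ, hψ]⟩

theorem or (hP : IsFirstOrder P) (hQ : IsFirstOrder Q) : IsFirstOrder fun v => P v ∨ Q v := by
  obtain ⟨φ, hφ⟩ := hP
  obtain ⟨ψ, hψ⟩ := hQ
  exact ⟨φ ⊔ ψ, fun v => by rw [Language.Formula.realize_sup, hφ, hψ]⟩

theorem imp (hP : IsFirstOrder P) (hQ : IsFirstOrder Q) : IsFirstOrder fun v => P v → Q v := by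
  obtain ⟨φ, hφ⟩ := hP
  obtain ⟨ψ, hψ⟩ := hQ
  exact ⟨φ.imp ψ, fun v => by rw [Language.Formula.realize_imp, hφ, hψ]⟩

theorem all {P : (α → L) → L → Prop}
    (hP : IsFirstOrder fun v : α ⊕ Unit → L => P (fun i => v (.inl i)) (v (.inr ()))) :
    IsFirstOrder fun v => ∀ x, P v x := by
  obtain ⟨φ, hφ⟩ := hP
  refine ⟨φ.iAlls Unit, fun v => ?_⟩
  rw [Language.Formula.realize_iAlls]
  exact ⟨fun h x => (hφ _).1 (h fun _ => x), fun h i => (hφ _).2 (h (i ()))⟩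

theorem ex {P : (α → L) → L → Prop}
    (hP : IsFirstOrder fun v : α ⊕ Unit → L => P (fun i => v (.inl i)) (v (.inr ()))) :
    IsFirstOrder fun v => ∃ x, P v x := by
  obtain ⟨φ, hφ⟩ := hP
  refine ⟨φ.iExs Unit, fun v => ?_⟩
  rw [Language.Formula.realize_iExs]
  exact ⟨fun ⟨i, h⟩ => ⟨i (), (hφ _).1 h⟩, fun ⟨x, h⟩ => ⟨fun _ => x, (hφ _).2 h⟩⟩

theorem eq (i j : α) : IsFirstOrder fun v : α → L => v i = v j :=
  ⟨(Language.Term.var i).equal (Language.Term.var j), fun v => by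
    rw [Language.Formula.realize_equal]
    rfl⟩

theorem eq_sup (i j k : α) : IsFirstOrder fun v : α → L => v i = v j ⊔ v k :=
  ⟨(Language.Term.var i).equal (Language.Term.func (l := 2) true ![.var j, .var k]), fun v => by
    rw [Language.Formula.realize_equal]
    rfl⟩

theorem le (i j : α) : IsFirstOrder fun v : α → L => v i ≤ v j := by
  simpa only [← sup_eq_right, eq_comm] using eq_sup (L := L) j i j

theorem isDominantAtom (i : α) : IsFirstOrder fun v : α → L => IsDominantAtom (v i) :=
  (all (le _ _)).neg.and <|
    (all <| (le _ _).imp <| (all (le _ _)).neg.imp (le _ _)).and <|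
      all <| (all <| (le _ _).imp <| (all (le _ _)).neg.imp (le _ _)).imp (le _ _)

theorem isIrredAboveAtom (i : α) : IsFirstOrder fun v : α → L => IsIrredAboveAtom (v i) :=
  (ex <| (isDominantAtom _).and (le _ _)).and <|
    (all (le _ _)).neg.and <| all <| all <| (eq_sup _ _ _).imp <| (eq _ _).or (eq _ _)

theorem isNthIrred (m : ℕ) (i : α) : IsFirstOrder fun v : α → L => IsNthIrred m (v i) := by
  induction m generalizing α with
  | zero => exact isDominantAtom i
  | succ m ih =>
    exact ex <| (ih _).and <| (le _ _).neg.and <| (isIrredAboveAtom _).and <|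
      all <| (isIrredAboveAtom _).imp <| (le _ _).neg.imp (le _ _)

theorem isNthNil (m : ℕ) (i : α) : IsFirstOrder fun v : α → L => IsNthNil m (v i) :=
  ex <| ex <| (isNthIrred m _).and <| (isDominantAtom _).and <| (le _ _).and <|
    (le _ _).neg.and <| all <| (le _ _).imp <| (le _ _).neg.imp (le _ _)

end IsFirstOrder

/-- **Theorem.** For every natural number `m ≥ 1`, the variety `D m = var{xᵐ = 0, xy = yx}`
is a definable element of the lattice **Com**. -/
theorem definable_Dvar (m : ℕ) (hm : 1 ≤ m) :
    LatDefinable ComVariety {V : ComVariety | V = Dvar m} := by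
  obtain ⟨m, rfl⟩ := Nat.exists_eq_add_of_le' hm
  obtain ⟨φ, hφ⟩ := IsFirstOrder.isNthNil (L := ComVariety) m (0 : Fin 1)
  exact ⟨φ, fun V => (hφ _).trans ComVariety.isNthNil_iff⟩
end

section
/- The set of all commutative semigroup varieties that are 0-reduced in Com (i.e., given within the variety COM of all commutative semigroups by 0-reduced identities only) is definable in the lattice Com. -/
open FirstOrder

/-! ### Fully invariant congruences of the free commutative semigroup

Elements of the free commutative semigroup over `ℕ` are nonzero multisets of letters. -/

/-- The additive extension to multisets of a map defined on letters. -/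
def msum {A : Type*} [AddCommMonoid A] (f : ℕ → A) : Multiset ℕ →+ A :=
  Multiset.sumAddMonoidHom.comp (Multiset.mapAddMonoidHom f)

theorem msum_apply {A : Type*} [AddCommMonoid A] (f : ℕ → A) (s : Multiset ℕ) :
    msum f s = (s.map f).sum := rfl

@[simp] theorem msum_singleton {A : Type*} [AddCommMonoid A] (f : ℕ → A) (n : ℕ) :
    msum f {n} = f n := by simp [msum_apply]

theorem map_msum {A B : Type*} [AddCommMonoid A] [AddCommMonoid B] (g : A →+ B) (f : ℕ → A)
    (s : Multiset ℕ) : g (msum f s) = msum (fun n => g (f n)) s := by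
  simp [msum_apply, map_multiset_sum, Multiset.map_map]

theorem msum_congr {A : Type*} [AddCommMonoid A] {f g : ℕ → A} {s : Multiset ℕ}
    (h : ∀ n ∈ s, f n = g n) : msum f s = msum g s := by
  rw [msum_apply, msum_apply, Multiset.map_congr rfl h]

theorem msum_const {A : Type*} [AddCommMonoid A] (a : A) (s : Multiset ℕ) :
    msum (fun _ => a) s = s.card • a := by simp [msum_apply]

theorem msum_singletons (s : Multiset ℕ) : msum (fun n => ({n} : Multiset ℕ)) s = s := by
  simp [msum_apply]

theorem mem_msum {f : ℕ → Multiset ℕ} {s : Multiset ℕ} {y : ℕ} :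
    y ∈ msum f s ↔ ∃ x ∈ s, y ∈ f x := by
  rw [msum_apply]; exact Multiset.mem_bind

theorem card_msum (f : ℕ → Multiset ℕ) (s : Multiset ℕ) :
    (msum f s).card = msum (fun n => (f n).card) s := by
  simpa using map_msum Multiset.cardHom f s

theorem card_le_msum {g : ℕ → ℕ} (hg : ∀ n, 1 ≤ g n) (s : Multiset ℕ) : s.card ≤ msum g s := by
  induction s using Multiset.induction with
  | empty => simp
  | cons a s ih =>
    rw [← Multiset.singleton_add, map_add, msum_singleton, Multiset.card_add]
    have := hg a
    simp only [Multiset.card_singleton]; omega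

theorem card_lt_msum {g : ℕ → ℕ} (hg : ∀ n, 1 ≤ g n) {s : Multiset ℕ} {x : ℕ} (hx : x ∈ s)
    (h : 2 ≤ g x) : s.card < msum g s := by
  obtain ⟨t, rfl⟩ := Multiset.exists_cons_of_mem hx
  have := card_le_msum hg t
  rw [← Multiset.singleton_add, map_add, msum_singleton, Multiset.card_add]
  simp only [Multiset.card_singleton]; omega

theorem one_le_card {s : Multiset ℕ} (h : s ≠ 0) : 1 ≤ s.card := Multiset.card_pos.2 h

theorem msum_ne_zero {f : ℕ → Multiset ℕ} (hf : ∀ n, f n ≠ 0) {s : Multiset ℕ} (hs : s ≠ 0) :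
    msum f s ≠ 0 := by
  rw [← Multiset.card_pos, card_msum]
  exact (Multiset.card_pos.2 hs).trans_le (card_le_msum (fun n => one_le_card (hf n)) s)

theorem nsmul_ne_zero_of_pos {n : ℕ} (hn : 1 ≤ n) {p : Multiset ℕ} (hp : p ≠ 0) :
    n • p ≠ 0 := by
  rw [← Multiset.card_pos, Multiset.card_nsmul]
  exact Nat.mul_pos hn (Multiset.card_pos.2 hp)

/-- The multiset of letters of a word. -/
def content (w : SGWord) : Multiset ℕ := w.head ::ₘ (w.tail : Multiset ℕ)

theorem content_ne_zero (w : SGWord) : content w ≠ 0 := Multiset.cons_ne_zero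

@[simp] theorem content_ltr (n : ℕ) : content (ltr n) = {n} := rfl

@[simp] theorem content_mul (u v : SGWord) : content (u * v) = content u + content v := by
  simp only [content, Multiset.cons_coe, Multiset.coe_add]
  rfl

theorem occursIn_iff {n : ℕ} {w : SGWord} : OccursIn n w ↔ n ∈ content w := by
  simp [OccursIn, content]

theorem exists_content_eq {s : Multiset ℕ} (hs : s ≠ 0) : ∃ w, content w = s := by
  obtain ⟨a, ha⟩ := Multiset.exists_mem_of_ne_zero hs
  obtain ⟨t, rfl⟩ := Multiset.exists_cons_of_mem ha
  induction t using Quot.inductionOn with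
  | _ l => exact ⟨⟨a, l⟩, rfl⟩

theorem content_lift (g : ℕ → SGWord) (w : SGWord) :
    content (FreeSemigroup.lift g w) = msum (fun n => content (g n)) (content w) := by
  induction w using FreeSemigroup.recOnMul with
  | ih1 x => change content (FreeSemigroup.lift g (FreeSemigroup.of x)) = msum _ (content (ltr x)); simp
  | ih2 x y hx hy => rw [map_mul, content_mul, hx, hy, content_mul, map_add]

/-- The value of a multiset of letters in a commutative semigroup with adjoined unit. -/
def evalM {S : Type} [CommSemigroup S] (f : ℕ → S) (s : Multiset ℕ) : WithOne S :=
  (s.map fun n => (f n : WithOne S)).prod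

theorem evalM_add {S : Type} [CommSemigroup S] (f : ℕ → S) (s t : Multiset ℕ) :
    evalM f (s + t) = evalM f s * evalM f t := by simp [evalM]

theorem evalM_content {S : Type} [CommSemigroup S] (f : ℕ → S) (w : SGWord) :
    evalM f (content w) = (FreeSemigroup.lift f w : S) := by
  induction w using FreeSemigroup.recOnMul with
  | ih1 x => change evalM f (content (ltr x)) = (FreeSemigroup.lift f (FreeSemigroup.of x) : S); simp [evalM]
  | ih2 x y hx hy => rw [content_mul, evalM_add, hx, hy, map_mul, WithOne.coe_mul]

theorem satisfies_iff {S : Type} [CommSemigroup S] {i : SGId} :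
    SGSatisfies S i ↔ ∀ f : ℕ → S, evalM f (content i.1) = evalM f (content i.2) := by
  simp only [evalM_content, WithOne.coe_inj, SGSatisfies]

/-- Fully invariant congruences of the free commutative monoid under substitutions of nonempty
words, in which `0` is a class of its own. -/
structure IsFI (r : Multiset ℕ → Multiset ℕ → Prop) : Prop where
  refl : ∀ s, r s s
  symm : ∀ {s t}, r s t → r t s
  trans : ∀ {s t u}, r s t → r t u → r s u
  add_right : ∀ {s t} u, r s t → r (s + u) (t + u)
  subst : ∀ {s t} (f : ℕ → Multiset ℕ), (∀ n, f n ≠ 0) → r s t → r (msum f s) (msum f t)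
  zero : ∀ {t}, r 0 t → t = 0

theorem IsFI.add_left {r : Multiset ℕ → Multiset ℕ → Prop} (h : IsFI r) {s t : Multiset ℕ}
    (u : Multiset ℕ) (hr : r s t) : r (u + s) (u + t) := by
  rw [add_comm u, add_comm u]; exact h.add_right u hr

theorem IsFI.ne_zero {r : Multiset ℕ → Multiset ℕ → Prop} (h : IsFI r) {s t : Multiset ℕ}
    (hr : r s t) (hs : s ≠ 0) : t ≠ 0 := by
  rintro rfl; exact hs (h.zero (h.symm hr))

namespace ComVariety

/-- The fully invariant congruence of a variety. -/
def rel (V : ComVariety) (s t : Multiset ℕ) : Prop :=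
  ∀ S ∈ modelsOf V.theory, ∀ f : ℕ → S.carrier, evalM f s = evalM f t

theorem mem_theory_iff_s4 (V : ComVariety) (i : SGId) :
    i ∈ V.theory ↔ V.rel (content i.1) (content i.2) := by
  conv_lhs => rw [← V.closed]
  exact forall₂_congr fun S _ => satisfies_iff

theorem isFI_rel (V : ComVariety) : IsFI V.rel where
  refl s S _ f := rfl
  symm h S hS f := (h S hS f).symm
  trans h h' S hS f := (h S hS f).trans (h' S hS f)
  add_right u h S hS f := by rw [evalM_add, evalM_add, h S hS f]
  subst {s t} g hg h S hS f := by
    have key : ∃ k : ℕ → S.carrier, ∀ s, evalM f (msum g s) = evalM k s := by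
      have : ∀ n, ∃ k : S.carrier, evalM f (g n) = k := fun n => by
        obtain ⟨w, hw⟩ := exists_content_eq (hg n)
        exact ⟨_, hw ▸ evalM_content f w⟩
      choose k hk using this
      refine ⟨k, fun s => ?_⟩
      induction s using Multiset.induction with
      | empty => simp [evalM]
      | cons a s ih =>
        rw [← Multiset.singleton_add, map_add, evalM_add, evalM_add, ih, msum_singleton, hk]
        simp [evalM]
    obtain ⟨k, hk⟩ := key
    rw [hk, hk, h S hS k]
  zero {t} h := by
    by_contra ht
    obtain ⟨w, rfl⟩ := exists_content_eq ht
    have := h ⟨PUnit⟩ (fun _ _ _ => rfl) (fun _ => PUnit.unit)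
    rw [evalM_content] at this
    simp [evalM] at this

theorem le_iff {V W : ComVariety} : V ≤ W ↔ ∀ s t, W.rel s t → V.rel s t := by
  constructor
  · intro h s t hr
    by_cases hs : s = 0
    · subst hs
      rw [W.isFI_rel.zero hr]; exact V.isFI_rel.refl _
    · obtain ⟨u, rfl⟩ := exists_content_eq hs
      obtain ⟨v, rfl⟩ := exists_content_eq (W.isFI_rel.ne_zero hr hs)
      exact (V.mem_theory_iff_s4 (u, v)).1 (h ((W.mem_theory_iff_s4 (u, v)).2 hr))
  · intro h i hi
    exact (V.mem_theory_iff_s4 i).2 (h _ _ ((W.mem_theory_iff_s4 i).1 hi))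

/-- The variety with a given fully invariant congruence. -/
def ofRel (r : Multiset ℕ → Multiset ℕ → Prop) (h : IsFI r) : ComVariety where
  theory := {i | r (content i.1) (content i.2)}
  closed := by
    refine subset_antisymm ?_ (subset_theoryOfClass_modelsOf _)
    intro i hi
    let c : Con SGWord :=
      { r := fun u v => r (content u) (content v)
        iseqv := ⟨fun _ => h.refl _, h.symm, h.trans⟩
        mul' := fun {a b c d} h1 h2 => by
          rw [content_mul, content_mul]
          exact h.trans (h.add_right _ h1) (h.add_left _ h2) }
    let inst : CommSemigroup c.Quotient :=
      { (inferInstance : Semigroup c.Quotient) with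
        mul_comm := fun a b => by
          induction a using Con.induction_on with
          | H a =>
            induction b using Con.induction_on with
            | H b =>
              rw [← Con.coe_mul, ← Con.coe_mul]
              refine (Con.eq c).2 ?_
              change r _ _
              rw [content_mul, content_mul, add_comm]
              exact h.refl _ }
    have hlift : ∀ (g : ℕ → SGWord) (w : SGWord),
        FreeSemigroup.lift (fun n => (g n : c.Quotient)) w
          = ((FreeSemigroup.lift g w : SGWord) : c.Quotient) := by
      intro g w
      induction w using FreeSemigroup.recOnMul with
      | ih1 x => rfl
      | ih2 x y hx hy => rw [map_mul, map_mul, Con.coe_mul, hx, hy]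
    have hne : Nonempty c.Quotient := ⟨(ltr 0 : SGWord)⟩
    have hmem : (⟨c.Quotient⟩ : ComSG) ∈
        modelsOf {i : SGId | r (content i.1) (content i.2)} := by
      intro j hj f
      have : ∃ g : ℕ → SGWord, f = fun n => (g n : c.Quotient) :=
        ⟨fun n => (f n).out, funext fun n => (Quotient.out_eq _).symm⟩
      obtain ⟨g, rfl⟩ := this
      change FreeSemigroup.lift (fun n => (g n : c.Quotient)) j.1 =
        FreeSemigroup.lift (fun n => (g n : c.Quotient)) j.2
      rw [hlift, hlift]
      refine (Con.eq c).2 ?_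
      change r _ _
      rw [content_lift, content_lift]
      exact h.subst _ (fun n => content_ne_zero _) hj
    have := hi _ hmem (fun n => ((ltr n : SGWord) : c.Quotient))
    change FreeSemigroup.lift (fun n => ((ltr n : SGWord) : c.Quotient)) i.1 =
      FreeSemigroup.lift (fun n => ((ltr n : SGWord) : c.Quotient)) i.2 at this
    rw [hlift, hlift] at this
    have h2 : r _ _ := (Con.eq c).1 this
    rw [content_lift, content_lift] at h2
    simp only [content_ltr, msum_singletons] at h2
    exact h2

theorem rel_ofRel {r : Multiset ℕ → Multiset ℕ → Prop} (h : IsFI r) {s t : Multiset ℕ} :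
    (ofRel r h).rel s t ↔ r s t := by
  constructor
  · intro hr
    by_cases hs : s = 0
    · subst hs
      rw [(ofRel r h).isFI_rel.zero hr]; exact h.refl _
    · obtain ⟨u, rfl⟩ := exists_content_eq hs
      obtain ⟨v, rfl⟩ := exists_content_eq ((ofRel r h).isFI_rel.ne_zero hr hs)
      exact ((ofRel r h).mem_theory_iff_s4 (u, v)).2 hr
  · intro hr
    by_cases hs : s = 0
    · subst hs
      rw [h.zero hr]; exact (ofRel r h).isFI_rel.refl _
    · obtain ⟨u, rfl⟩ := exists_content_eq hs
      obtain ⟨v, rfl⟩ := exists_content_eq (h.ne_zero hr hs)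
      exact ((ofRel r h).mem_theory_iff_s4 (u, v)).1 hr

theorem rel_sup {V W : ComVariety} {s t : Multiset ℕ} :
    (V ⊔ W).rel s t ↔ V.rel s t ∧ W.rel s t := by
  have hV := V.isFI_rel
  have hW := W.isFI_rel
  have h : IsFI fun s t => V.rel s t ∧ W.rel s t :=
    { refl := fun s => ⟨hV.refl s, hW.refl s⟩
      symm := fun h => ⟨hV.symm h.1, hW.symm h.2⟩
      trans := fun h h' => ⟨hV.trans h.1 h'.1, hW.trans h.2 h'.2⟩
      add_right := fun u h => ⟨hV.add_right u h.1, hW.add_right u h.2⟩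
      subst := fun f hf h => ⟨hV.subst f hf h.1, hW.subst f hf h.2⟩
      zero := fun h => hV.zero h.1 }
  refine ⟨fun hr => ⟨le_iff.1 le_sup_left _ _ hr, le_iff.1 le_sup_right _ _ hr⟩, fun hr => ?_⟩
  have hle : V ⊔ W ≤ ofRel _ h :=
    sup_le (le_iff.2 fun _ _ h' => ((rel_ofRel h).1 h').1)
      (le_iff.2 fun _ _ h' => ((rel_ofRel h).1 h').2)
  exact le_iff.1 hle _ _ ((rel_ofRel h).2 hr)

/-- Any property preserved by one-step passages along the congruences of `V` and `W` is preserved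
by the congruence of `V ⊓ W`. -/
theorem rel_inf_induction {V W : ComVariety} {p : Multiset ℕ → Prop}
    (hV : ∀ s t, V.rel s t → p s → p t) (hW : ∀ s t, W.rel s t → p s → p t) {s t : Multiset ℕ}
    (hr : (V ⊓ W).rel s t) (hs : p s) : p t := by
  have fV := V.isFI_rel
  have fW := W.isFI_rel
  let q : Multiset ℕ → Multiset ℕ → Prop := fun a b => V.rel a b ∨ W.rel a b
  have h : IsFI (Relation.ReflTransGen q) :=
    { refl := fun s => .refl
      symm := fun h => by
        induction h with
        | refl => exact .refl
        | tail _ h ih => exact .head (h.imp fV.symm fW.symm) ih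
      trans := fun h h' => h.trans h'
      add_right := fun u h => by
        induction h with
        | refl => exact .refl
        | tail _ h ih => exact ih.tail (h.imp (fV.add_right u) (fW.add_right u))
      subst := fun f hf h => by
        induction h with
        | refl => exact .refl
        | tail _ h ih => exact ih.tail (h.imp (fV.subst f hf) (fW.subst f hf))
      zero := fun h => by
        induction h with
        | refl => rfl
        | tail _ h ih => subst ih; exact h.elim fV.zero fW.zero }
  have hle : ofRel _ h ≤ V ⊓ W :=
    le_inf (le_iff.2 fun _ _ h' => (rel_ofRel h).2 (.single (Or.inl h')))
      (le_iff.2 fun _ _ h' => (rel_ofRel h).2 (.single (Or.inr h')))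
  have h0 := (rel_ofRel h).1 (le_iff.1 hle _ _ hr)
  clear hr
  induction h0 with
  | refl => exact hs
  | tail _ h2 ih => exact h2.elim (fun h => hV _ _ h ih) (fun h => hW _ _ h ih)

theorem rel_inf_left {V W : ComVariety} {s t : Multiset ℕ} (h : V.rel s t) : (V ⊓ W).rel s t :=
  le_iff.1 inf_le_left _ _ h

theorem rel_inf_right {V W : ComVariety} {s t : Multiset ℕ} (h : W.rel s t) : (V ⊓ W).rel s t :=
  le_iff.1 inf_le_right _ _ h

theorem eq_bot_iff_rel {V : ComVariety} : V = ⊥ ↔ ∀ s t, s ≠ 0 → t ≠ 0 → V.rel s t := by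
  constructor
  · rintro rfl s t hs ht
    have h : IsFI fun s t => (s = 0 ↔ t = 0) :=
      { refl := fun _ => Iff.rfl
        symm := Iff.symm
        trans := Iff.trans
        add_right := fun u h => by simp only [add_eq_zero, h]
        subst := fun {s t} f hf h => by
          by_cases hs : s = 0
          · simp [hs, h.1 hs]
          · simp [msum_ne_zero hf hs, msum_ne_zero hf (mt h.2 hs)]
        zero := fun h => h.1 rfl }
    exact le_iff.1 (bot_le (a := ofRel _ h)) _ _ ((rel_ofRel h).2 (by simp [hs, ht]))
  · intro h
    refine le_bot_iff.1 (le_iff.2 fun s t hr => ?_)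
    by_cases hs : s = 0
    · subst hs
      rw [(⊥ : ComVariety).isFI_rel.zero hr]; exact V.isFI_rel.refl _
    · exact h s t hs ((⊥ : ComVariety).isFI_rel.ne_zero hr hs)

theorem eq_top_of_rel {V : ComVariety} (h : ∀ s t, V.rel s t → s = t) : V = ⊤ :=
  top_le_iff.1 (le_iff.2 fun s t hr => h s t hr ▸ (⊤ : ComVariety).isFI_rel.refl _)

end ComVariety

open ComVariety

/-! ### Rees congruences and 0-reduced varieties -/

/-- Fully invariant ideals of the free commutative semigroup. -/
structure IsFIIdeal (I : Set (Multiset ℕ)) : Prop where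
  ne_zero : ∀ {s}, s ∈ I → s ≠ 0
  add_mem : ∀ {s} t, s ∈ I → s + t ∈ I
  subst : ∀ {s} (f : ℕ → Multiset ℕ), (∀ n, f n ≠ 0) → s ∈ I → msum f s ∈ I

theorem IsFIIdeal.isFI {I : Set (Multiset ℕ)} (h : IsFIIdeal I) :
    IsFI fun s t => s = t ∨ (s ∈ I ∧ t ∈ I) where
  refl _ := Or.inl rfl
  symm := by grind
  trans := by grind
  add_right u := by
    rintro (rfl | ⟨h1, h2⟩)
    · exact Or.inl rfl
    · exact Or.inr ⟨h.add_mem u h1, h.add_mem u h2⟩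
  subst f hf := by
    rintro (rfl | ⟨h1, h2⟩)
    · exact Or.inl rfl
    · exact Or.inr ⟨h.subst f hf h1, h.subst f hf h2⟩
  zero := by
    rintro t (h1 | ⟨h1, -⟩)
    · exact h1.symm
    · exact absurd rfl (h.ne_zero h1)

/-- The variety whose congruence is the Rees congruence of an ideal. -/
def reesVar (I : Set (Multiset ℕ)) (h : IsFIIdeal I) : ComVariety := ofRel _ h.isFI

theorem rel_reesVar {I : Set (Multiset ℕ)} (h : IsFIIdeal I) {s t : Multiset ℕ} :
    (reesVar I h).rel s t ↔ s = t ∨ (s ∈ I ∧ t ∈ I) := rel_ofRel h.isFI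

/-- The ideal of all words of length at least `k`. -/
theorem isFIIdeal_card {k : ℕ} (hk : 1 ≤ k) : IsFIIdeal {s | k ≤ s.card} where
  ne_zero h := Multiset.card_pos.1 (hk.trans h)
  add_mem t hs := hs.trans (Multiset.card_le_card (Multiset.le_add_right _ t))
  subst f hf hs :=
    (hs.trans (card_le_msum (fun n => one_le_card (hf n)) _)).trans (card_msum f _).ge

theorem comVar_theory_subset {E : Set SGId} {V : ComVariety} (h : E ⊆ V.theory) :
    V ≤ comVar E := by
  have := theoryOfClass_antitone (modelsOf_antitone h)
  rwa [V.closed] at this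

theorem rel_comVar_of_mem {E : Set SGId} {i : SGId} (h : i ∈ E) :
    (comVar E).rel (content i.1) (content i.2) :=
  ((comVar E).mem_theory_iff_s4 i).1 (subset_theoryOfClass_modelsOf E h)

theorem rel_add_of_fresh (V : ComVariety) {s : Multiset ℕ} {n : ℕ} (hn : n ∉ s)
    (h : V.rel (s + {n}) s) {t : Multiset ℕ} (ht : t ≠ 0) : V.rel (s + t) s := by
  have := V.isFI_rel.subst (fun k => if k = n then t else {k})
    (fun k => by split_ifs <;> simp [ht]) h
  have hs : msum (fun k => if k = n then t else {k}) s = s := by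
    conv_rhs => rw [← msum_singletons s]
    exact msum_congr fun k hk => if_neg (by rintro rfl; exact hn hk)
  simpa [hs] using this

theorem isZeroReduced_iff {V : ComVariety} :
    IsZeroReduced V ↔ ∃ I, ∃ h : IsFIIdeal I, V = reesVar I h := by
  constructor
  · rintro ⟨P, hP, rfl⟩
    set E : Set SGId := ⋃ p ∈ P, zeroId p.1 p.2 with hE
    let V := comVar E
    have fV := V.isFI_rel
    have hI : IsFIIdeal {s | s ≠ 0 ∧ ∀ t, t ≠ 0 → V.rel (s + t) s} :=
      { ne_zero := And.left
        add_mem := fun {s} t hs => ⟨by simp [hs.1], fun u hu => by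
          rw [add_right_comm]; exact fV.add_right t (hs.2 u hu)⟩
        subst := fun {s} f hf hs => ⟨msum_ne_zero hf hs.1, fun t ht => by
          obtain ⟨n, hn⟩ := Infinite.exists_notMem_finset s.toFinset
          have hn : n ∉ s := by simpa using hn
          have := fV.subst (fun k => if k = n then t else f k)
            (fun k => by split_ifs <;> simp [ht, hf]) (hs.2 {n} (by simp))
          have h2 : msum (fun k => if k = n then t else f k) s = msum f s :=
            msum_congr fun k hk => if_neg (by rintro rfl; exact hn hk)
          simpa [h2] using this⟩ }
    refine ⟨_, hI, le_antisymm ?_ ?_⟩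
    · refine le_iff.2 fun s t hr => ?_
      obtain rfl | ⟨hs, ht⟩ := (rel_reesVar hI).1 hr
      · exact fV.refl _
      · refine fV.trans (fV.symm (hs.2 t ht.1)) ?_
        rw [add_comm]; exact ht.2 s hs.1
    · refine comVar_theory_subset fun i hi => ?_
      obtain ⟨p, hp, hip⟩ := Set.mem_iUnion₂.1 hi
      have hfresh : p.2 ∉ content p.1 := fun h => hP p hp (occursIn_iff.2 h)
      have hmem : content p.1 ∈ {s | s ≠ 0 ∧ ∀ t, t ≠ 0 → V.rel (s + t) s} := by
        refine ⟨content_ne_zero _, fun t ht => rel_add_of_fresh V hfresh ?_ ht⟩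
        have : (p.1 * ltr p.2, p.1) ∈ E := Set.mem_iUnion₂.2 ⟨p, hp, Or.inl rfl⟩
        simpa using rel_comVar_of_mem this
      rw [mem_theory_iff_s4, rel_reesVar]
      right
      obtain rfl | rfl := hip
      · exact ⟨by rw [content_mul]; exact hI.add_mem _ hmem, hmem⟩
      · exact ⟨by rw [content_mul, add_comm]; exact hI.add_mem _ hmem, hmem⟩
  · rintro ⟨I, hI, rfl⟩
    refine ⟨{p | content p.1 ∈ I ∧ ¬ OccursIn p.2 p.1}, fun p hp => hp.2, le_antisymm ?_ ?_⟩
    · refine comVar_theory_subset fun i hi => ?_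
      obtain ⟨p, ⟨hp, -⟩, hip⟩ := Set.mem_iUnion₂.1 hi
      rw [mem_theory_iff_s4, rel_reesVar]
      right
      obtain rfl | rfl := hip
      · exact ⟨by rw [content_mul]; exact hI.add_mem _ hp, hp⟩
      · exact ⟨by rw [content_mul, add_comm]; exact hI.add_mem _ hp, hp⟩
    · set V := comVar (⋃ p ∈ {p : SGWord × ℕ | content p.1 ∈ I ∧ ¬ OccursIn p.2 p.1},
        zeroId p.1 p.2) with hV
      have key : ∀ s ∈ I, ∀ t, t ≠ 0 → V.rel (s + t) s := by
        intro s hs t ht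
        obtain ⟨w, rfl⟩ := exists_content_eq (hI.ne_zero hs)
        obtain ⟨n, hn⟩ := Infinite.exists_notMem_finset (content w).toFinset
        have hn : n ∉ content w := by simpa using hn
        refine rel_add_of_fresh V hn ?_ ht
        have hmem : (w * ltr n, w) ∈
            ⋃ p ∈ {p : SGWord × ℕ | content p.1 ∈ I ∧ ¬ OccursIn p.2 p.1}, zeroId p.1 p.2 :=
          Set.mem_iUnion₂.2 ⟨(w, n), ⟨hs, fun h => hn (occursIn_iff.1 h)⟩, Or.inl rfl⟩
        have := rel_comVar_of_mem hmem
        simp only [content_mul, content_ltr] at this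
        exact this
      refine le_iff.2 fun s t hr => ?_
      obtain rfl | ⟨hs, ht⟩ := (rel_reesVar hI).1 hr
      · exact V.isFI_rel.refl _
      · refine V.isFI_rel.trans (V.isFI_rel.symm (key s hs t (hI.ne_zero ht))) ?_
        rw [add_comm]; exact key t ht s (hI.ne_zero hs)

/-! ### Lower-modular elements -/

/-- A lower-modular element of a lattice. -/
def IsLowerModular {α : Type*} [Lattice α] (x : α) : Prop :=
  ∀ y z, x ⊔ y = y → y ⊓ (x ⊔ z) = x ⊔ (y ⊓ z)

theorem isLowerModular_reesVar {I : Set (Multiset ℕ)} (h : IsFIIdeal I) :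
    IsLowerModular (reesVar I h) := by
  intro y z hxy
  have hxy : reesVar I h ≤ y := sup_eq_right.1 hxy
  refine le_antisymm (le_iff.2 fun a b hr => ?_) (le_inf (sup_le hxy inf_le_left)
    (sup_le_sup_left inf_le_right _))
  obtain ⟨h1, h2⟩ := rel_sup.1 hr
  have fJ := (y ⊓ (reesVar I h ⊔ z)).isFI_rel
  obtain rfl | ⟨ha, hb⟩ := (rel_reesVar h).1 h1
  · exact fJ.refl _
  have back : ∀ {c c'}, c' ∈ I → c ∈ I → z.rel c' c → (y ⊓ (reesVar I h ⊔ z)).rel a c' →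
      (y ⊓ (reesVar I h ⊔ z)).rel a c := fun hc' hc hz hJ =>
    fJ.trans hJ (rel_inf_right (rel_sup.2 ⟨(rel_reesVar h).2 (Or.inr ⟨hc', hc⟩), hz⟩))
  obtain ⟨c', hc', hJ, hz⟩ := rel_inf_induction
    (p := fun c => ∃ c' ∈ I, (y ⊓ (reesVar I h ⊔ z)).rel a c' ∧ z.rel c' c)
    (fun c d hcd ⟨c', hc', hJ, hz⟩ => by
      obtain rfl | ⟨hc, hd⟩ := (rel_reesVar h).1 (le_iff.1 hxy _ _ hcd)
      · exact ⟨c', hc', hJ, hz⟩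
      · exact ⟨d, hd, fJ.trans (back hc' hc hz hJ) (rel_inf_left hcd), z.isFI_rel.refl _⟩)
    (fun c d hcd ⟨c', hc', hJ, hz⟩ => ⟨c', hc', hJ, z.isFI_rel.trans hz hcd⟩) h2
    ⟨a, ha, fJ.refl _, z.isFI_rel.refl _⟩
  exact back hc' hb hz hJ

/-! ### Semilattices and varieties not containing them -/

theorem isFI_support : IsFI fun s t : Multiset ℕ => ∀ x, x ∈ s ↔ x ∈ t where
  refl _ _ := Iff.rfl
  symm h x := (h x).symm
  trans h h' x := (h x).trans (h' x)
  add_right u h x := by rw [Multiset.mem_add, Multiset.mem_add, h]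
  subst f hf h x := by simp only [mem_msum, h]
  zero h := Multiset.eq_zero_of_forall_notMem fun x hx => by simpa using (h x).2 hx

/-- The variety of semilattices: words are identified when they have the same letters. -/
def semilatticeVar : ComVariety := ofRel _ isFI_support

theorem rel_semilatticeVar {s t : Multiset ℕ} :
    semilatticeVar.rel s t ↔ ∀ x, x ∈ s ↔ x ∈ t := rel_ofRel isFI_support

theorem semilatticeVar_nsmul {n : ℕ} (hn : 1 ≤ n) (p : Multiset ℕ) :
    semilatticeVar.rel p (n • p) := by
  rw [rel_semilatticeVar]
  intro x
  have hn0 : n ≠ 0 := by omega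
  simp [Multiset.mem_nsmul, hn0]

/-- A congruence identifying words with different letters is Archimedean: some power of every
word absorbs the same power of every other word. -/
theorem exists_absorbing {V : ComVariety} (h : ¬ semilatticeVar ≤ V) :
    ∃ N, 1 ≤ N ∧ ∀ p q : Multiset ℕ, p ≠ 0 → q ≠ 0 → V.rel (N • p) (N • p + N • q) := by
  have fV := V.isFI_rel
  obtain ⟨s, t, w, hr, hwt, hws⟩ : ∃ s t w, V.rel s t ∧ w ∈ t ∧ w ∉ s := by
    by_contra! hc
    refine h (le_iff.2 fun s t hr => rel_semilatticeVar.2 fun x => ?_)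
    exact ⟨fun hx => hc t s x (fV.symm hr) hx, fun hx => hc s t x hr hx⟩
  have ht0 : t ≠ 0 := by rintro rfl; simp at hwt
  have hs0 : s ≠ 0 := fV.ne_zero (fV.symm hr) ht0
  obtain ⟨n, k, m, hn, hm, hnkm⟩ : ∃ n k m : ℕ, 1 ≤ n ∧ 1 ≤ m ∧ ∀ p q : Multiset ℕ, p ≠ 0 →
      q ≠ 0 → V.rel (n • p) (k • p + m • q) := by
    refine ⟨s.card, (t.filter fun x => ¬ w = x).card, t.count w, one_le_card hs0,
      Multiset.count_pos.2 hwt, fun p q hp hq => ?_⟩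
    have := fV.subst (fun x => if w = x then q else p) (fun x => by split_ifs <;> assumption) hr
    have h1 : msum (fun x => if w = x then q else p) s = s.card • p := by
      rw [← msum_const]
      exact msum_congr fun x hx => if_neg (by rintro rfl; exact hws hx)
    have h2 : msum (fun x => if w = x then q else p) t =
        (t.filter fun x => ¬ w = x).card • p + t.count w • q := by
      conv_lhs => rw [← Multiset.filter_add_not (fun x => w = x) t, map_add]
      rw [add_comm, Multiset.count_eq_card_filter_eq, ← msum_const, ← msum_const]
      congr 1 <;> refine msum_congr fun x hx => ?_
      · exact if_neg (Multiset.mem_filter.1 hx).2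
      · exact if_pos (Multiset.mem_filter.1 hx).2
    rwa [h1, h2] at this
  have absorb : ∀ p q : Multiset ℕ, p ≠ 0 → q ≠ 0 → V.rel (n • p) (n • p + m • q) := by
    intro p q hp hq
    have h1 := hnkm p (2 • q) hp (nsmul_ne_zero_of_pos (by norm_num) hq)
    have h2 := fV.add_right (m • q) (hnkm p q hp hq)
    have e : k • p + m • (2 • q) = k • p + m • q + m • q := by
      rw [two_nsmul, nsmul_add, add_assoc]
    rw [e] at h1
    exact fV.trans h1 (fV.symm h2)
  refine ⟨n * m, Nat.mul_pos hn hm, fun p q hp hq => ?_⟩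
  have h1 := fV.add_right ((n * m - n) • p) (absorb p (n • q) hp (nsmul_ne_zero_of_pos hn hq))
  have hle : n ≤ n * m := Nat.le_mul_of_pos_right n hm
  rw [add_right_comm, ← add_nsmul, Nat.add_sub_cancel' hle, smul_smul, mul_comm m n] at h1
  exact h1

theorem semilatticeVar_le {a : ComVariety} (ha : a ≠ ⊥) (h : a ≤ semilatticeVar) :
    semilatticeVar ≤ a := by
  by_contra hc
  have fa := a.isFI_rel
  obtain ⟨N, hN, hab⟩ := exists_absorbing hc
  refine ha (eq_bot_iff_rel.2 fun p q hp hq => ?_)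
  have hp' : a.rel p (N • p) := le_iff.1 h _ _ (semilatticeVar_nsmul hN p)
  have hq' : a.rel q (N • q) := le_iff.1 h _ _ (semilatticeVar_nsmul hN q)
  refine fa.trans hp' (fa.trans (hab p q hp hq) (fa.symm ?_))
  rw [add_comm]
  exact fa.trans hq' (hab q p hq hp)

theorem le_semilatticeVar {V : ComVariety} (h : V.rel {0} (2 • {0})) : V ≤ semilatticeVar := by
  have fV := V.isFI_rel
  have idem : ∀ x : ℕ, V.rel {x} ({x} + {x}) := fun x => by
    have := fV.subst (fun _ => {x}) (fun _ => by simp) h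
    rwa [map_nsmul, msum_singleton, two_nsmul] at this
  have dedup : ∀ s : Multiset ℕ, V.rel s s.dedup := by
    intro s
    induction s using Multiset.induction with
    | empty => simpa using fV.refl _
    | cons a s ih =>
      by_cases ha : a ∈ s
      · rw [Multiset.dedup_cons_of_mem ha]
        refine fV.trans ?_ ih
        obtain ⟨t, rfl⟩ := Multiset.exists_cons_of_mem ha
        have := fV.symm (fV.add_right t (idem a))
        rwa [add_assoc, Multiset.singleton_add, Multiset.singleton_add] at this
      · rw [Multiset.dedup_cons_of_notMem ha, ← Multiset.singleton_add, ← Multiset.singleton_add]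
        exact fV.add_left _ ih
  refine le_iff.2 fun s t hr => ?_
  have := dedup s
  rw [Multiset.dedup_ext.2 fun x => rel_semilatticeVar.1 hr x] at this
  exact fV.trans this (fV.symm (dedup t))

/-! ### Null semigroups and Abelian groups of finite exponent -/

/-- The variety of null semigroups. -/
def nullVar : ComVariety := reesVar {s | 2 ≤ s.card} (isFIIdeal_card one_le_two)

theorem rel_nullVar {s t : Multiset ℕ} :
    nullVar.rel s t ↔ s = t ∨ (2 ≤ s.card ∧ 2 ≤ t.card) := rel_reesVar _

theorem exists_rel_nsmul {X : ComVariety} (h : ¬ nullVar ≤ X) :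
    ∃ k, 2 ≤ k ∧ ∀ p : Multiset ℕ, X.rel p (k • p) := by
  have fX := X.isFI_rel
  obtain ⟨s, t, hr, hst, hs⟩ : ∃ s t, X.rel s t ∧ s ≠ t ∧ s.card < 2 := by
    by_contra! hc
    refine h (le_iff.2 fun s t hr => rel_nullVar.2 (or_iff_not_imp_left.2 fun hst => ?_))
    exact ⟨hc s t hr hst, hc t s (fX.symm hr) (Ne.symm hst)⟩
  have hs0 : s ≠ 0 := by
    rintro rfl; exact hst (fX.zero hr).symm
  have ht0 : t ≠ 0 := fX.ne_zero hr hs0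
  have h1 := one_le_card hs0
  have h2 := one_le_card ht0
  have hs1 : s.card = 1 := by omega
  have zero : ∀ n : ℕ, X.rel 0 (n • 0) := fun n => by simpa using fX.refl 0
  by_cases ht1 : t.card = 1
  · obtain ⟨x, rfl⟩ := Multiset.card_eq_one.1 hs1
    obtain ⟨y, rfl⟩ := Multiset.card_eq_one.1 ht1
    have hxy : y ≠ x := by rintro rfl; exact hst rfl
    refine ⟨2, le_rfl, fun p => ?_⟩
    by_cases hp : p = 0
    · exact hp ▸ zero 2
    have hp2 : 2 • p ≠ 0 := nsmul_ne_zero_of_pos one_le_two hp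
    simpa [hxy] using fX.subst (fun z => if z = x then p else 2 • p)
      (fun z => by split_ifs <;> assumption) hr
  · refine ⟨t.card, by omega, fun p => ?_⟩
    by_cases hp : p = 0
    · exact hp ▸ zero _
    simpa [msum_const, hs1] using fX.subst (fun _ => p) (fun _ => hp) hr

theorem isFI_group (n : ℕ) :
    IsFI fun s t : Multiset ℕ => (s = 0 ↔ t = 0) ∧ ∃ a b, s + n • a = t + n • b where
  refl s := ⟨Iff.rfl, 0, 0, rfl⟩
  symm := fun ⟨h, a, b, hab⟩ => ⟨h.symm, b, a, hab.symm⟩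
  trans := by
    rintro s t u ⟨h, a, b, hab⟩ ⟨h', c, d, hcd⟩
    refine ⟨h.trans h', a + c, b + d, ?_⟩
    rw [nsmul_add, nsmul_add, ← add_assoc, hab, add_right_comm, hcd, add_right_comm, add_assoc]
  add_right := by
    rintro s t u ⟨h, a, b, hab⟩
    refine ⟨by simp only [add_eq_zero, h], a, b, ?_⟩
    rw [add_right_comm, hab, add_right_comm]
  subst := by
    rintro s t f hf ⟨h, a, b, hab⟩
    refine ⟨?_, msum f a, msum f b, ?_⟩
    · by_cases hs : s = 0
      · simp [hs, h.1 hs]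
      · simp [msum_ne_zero hf hs, msum_ne_zero hf (mt h.2 hs)]
    · simpa only [map_add, map_nsmul] using congrArg (msum f) hab
  zero h := h.1.1 rfl

/-- The variety of Abelian groups of exponent dividing `n`. -/
def groupVar (n : ℕ) : ComVariety := ofRel _ (isFI_group n)

theorem rel_groupVar {n : ℕ} {s t : Multiset ℕ} :
    (groupVar n).rel s t ↔ (s = 0 ↔ t = 0) ∧ ∃ a b, s + n • a = t + n • b :=
  rel_ofRel (isFI_group n)

theorem groupVar_rel_add_nsmul {n : ℕ} {s : Multiset ℕ} (hs : s ≠ 0) (a : Multiset ℕ) :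
    (groupVar n).rel s (s + n • a) :=
  rel_groupVar.2 ⟨by simp [hs], a, 0, by simp⟩

/-- `a` is the least nontrivial subvariety of `U`. -/
def IsLeastNonbot {α : Type*} [Lattice α] [OrderBot α] (a U : α) : Prop :=
  a ≠ ⊥ ∧ a ≤ U ∧ ∀ X ≤ U, X = ⊥ ∨ a ≤ X

theorem semilatticeVar_ne_bot : semilatticeVar ≠ ⊥ := by
  intro h
  have := rel_semilatticeVar.1 (eq_bot_iff_rel.1 h {0} {1} (by simp) (by simp)) 0
  simp at this

theorem eq_bot_of_rel {V : ComVariety} (h : V.rel {0} {1}) : V = ⊥ := by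
  refine eq_bot_iff_rel.2 fun s t hs ht => ?_
  simpa using V.isFI_rel.subst (fun n => if n = 0 then s else t)
    (fun n => by split_ifs <;> assumption) h

/-- The monogenic subsemigroup of the free object of `U` generated by a letter satisfies all
identities of `U`. -/
theorem isFI_monogenic (U : ComVariety) :
    IsFI fun s t : Multiset ℕ => ∀ g : ℕ → ℕ, (∀ n, 1 ≤ g n) →
      U.rel (msum g s • {0}) (msum g t • {0}) where
  refl s g _ := U.isFI_rel.refl _
  symm h g hg := U.isFI_rel.symm (h g hg)
  trans h h' g hg := U.isFI_rel.trans (h g hg) (h' g hg)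
  add_right u h g hg := by
    rw [map_add, map_add, add_nsmul, add_nsmul]; exact U.isFI_rel.add_right _ (h g hg)
  subst f hf h g hg := by
    rw [map_msum, map_msum]
    exact h _ fun n => (one_le_card (hf n)).trans (card_le_msum hg _)
  zero {t} h := by
    have := U.isFI_rel.zero (t := t.card • {0})
      (by simpa [msum_const] using h (fun _ => 1) (fun _ => le_rfl))
    simpa using congrArg Multiset.card this

theorem rel_two_nsmul_of_groupVar_inf_eq_bot {U : ComVariety} {k : ℕ}
    (hk : ∀ p : Multiset ℕ, U.rel p ((k + 1) • p))
    (h : groupVar k ⊓ U = ⊥) : U.rel {0} (2 • {0}) := by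
  have fU := U.isFI_rel
  have hle : ofRel _ (isFI_monogenic U) ≤ groupVar k ⊓ U := by
    refine le_inf (le_iff.2 fun s t hr => ?_) (le_iff.2 fun s t hr => ?_)
    · rw [rel_ofRel]
      intro g hg
      obtain ⟨h0, a, b, hab⟩ := rel_groupVar.1 hr
      by_cases hs : s = 0
      · rw [hs, h0.1 hs]; exact fU.refl _
      have period : ∀ i j : ℕ, 1 ≤ i → U.rel (i • {0}) ((i + k * j) • {0}) := by
        intro i j hi
        induction j with
        | zero => exact fU.refl _
        | succ j ih =>
          refine fU.trans ih ?_
          obtain ⟨m, hm⟩ : ∃ m, i + k * j = m + 1 := ⟨i + k * j - 1, by omega⟩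
          have := fU.add_right (m • {0}) (hk {0})
          rwa [← succ_nsmul', ← add_nsmul, ← hm, show k + 1 + m = i + k * (j + 1) by
            rw [mul_add]; omega] at this
      have hs1 := (one_le_card hs).trans (card_le_msum hg s)
      have ht1 := (one_le_card (mt h0.2 hs)).trans (card_le_msum hg t)
      have e := congrArg (msum g) hab
      simp only [map_add, map_nsmul, smul_eq_mul] at e
      have := period _ (msum g a) hs1
      rw [e] at this
      exact fU.trans this (fU.symm (period _ _ ht1))
    · rw [rel_ofRel]
      intro g hg
      have := fU.subst (fun n => g n • {0}) (fun n => nsmul_ne_zero_of_pos (hg n) (by simp)) hr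
      have e : ∀ s, msum (fun n => g n • ({0} : Multiset ℕ)) s = msum g s • {0} := fun s =>
        (map_msum (multiplesHom _ ({0} : Multiset ℕ)) g s).symm
      rwa [e, e] at this
  have hbot := le_bot_iff.1 (h ▸ hle)
  have := (rel_ofRel _).1 (eq_bot_iff_rel.1 hbot {0} {1} (by simp) (by simp))
    (fun n => n + 1) (fun n => by omega)
  simpa using this

theorem IsLeastNonbot.le_semilatticeVar {a U : ComVariety} (h : IsLeastNonbot a U)
    (hU : semilatticeVar ≤ U) : U ≤ semilatticeVar := by
  obtain ⟨ha, haU, hleast⟩ := h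
  have fa := a.isFI_rel
  have haS : a ≤ semilatticeVar := (hleast _ hU).resolve_left semilatticeVar_ne_bot
  have power : ∀ {n : ℕ} (p : Multiset ℕ), 1 ≤ n → a.rel p (n • p) := fun p hn =>
    le_iff.1 haS _ _ (semilatticeVar_nsmul hn p)
  have hnull : ¬ nullVar ≤ U := by
    intro hc
    obtain h0 | h0 := hleast _ hc
    · rcases rel_nullVar.1 (eq_bot_iff_rel.1 h0 {0} {1} (by simp) (by simp)) with h1 | h1 <;>
        simp at h1
    · refine ha (eq_bot_of_rel (fa.trans (power {0} one_le_two)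
        (fa.trans (le_iff.1 h0 _ _ ?_) (fa.symm (power {1} one_le_two)))))
      exact rel_nullVar.2 (Or.inr (by simp))
  obtain ⟨k, hk, hkU⟩ := exists_rel_nsmul hnull
  obtain ⟨k, rfl⟩ : ∃ j, k = j + 1 := ⟨k - 1, by omega⟩
  refine _root_.le_semilatticeVar (rel_two_nsmul_of_groupVar_inf_eq_bot hkU ?_)
  refine (hleast _ inf_le_right).resolve_right fun hag => ha (eq_bot_of_rel ?_)
  have hag := le_iff.1 (hag.trans inf_le_left)
  refine fa.trans (hag _ _ (groupVar_rel_add_nsmul (by simp) {1})) (fa.trans ?_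
    (fa.symm (hag _ _ (groupVar_rel_add_nsmul (by simp) {0}))))
  refine le_iff.1 haS _ _ (rel_semilatticeVar.2 fun x => ?_)
  have : k ≠ 0 := by omega
  simp [Multiset.mem_nsmul, this, or_comm]

/-! ### Lower-modular varieties not containing semilattices -/

theorem isFI_length (d : ℕ) : IsFI fun s t : Multiset ℕ =>
    s = t ∨ (s.card = d ∧ t.card = d ∧ ∀ x, x ∈ s ↔ x ∈ t) ∨ (d < s.card ∧ d < t.card) where
  refl _ := Or.inl rfl
  symm := by grind
  trans := by grind
  add_right u := by
    rintro (rfl | ⟨hs, ht, h⟩ | ⟨hs, ht⟩)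
    · exact Or.inl rfl
    · right
      simp only [Multiset.card_add, Multiset.mem_add, hs, ht, h]
      by_cases hu : u.card = 0
      · left; simp [hu]
      · right; omega
    · right; right
      simp only [Multiset.card_add]; omega
  subst {s t} f hf := by
    have hf1 := fun n => one_le_card (hf n)
    rintro (rfl | ⟨hs, ht, h⟩ | ⟨hs, ht⟩)
    · exact Or.inl rfl
    · right
      by_cases hx : ∃ x ∈ s, 2 ≤ (f x).card
      · obtain ⟨x, hx, hfx⟩ := hx
        right
        rw [card_msum, card_msum]
        exact ⟨hs ▸ card_lt_msum hf1 hx hfx, ht ▸ card_lt_msum hf1 ((h x).1 hx) hfx⟩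
      · push Not at hx
        left
        have hone : ∀ u : Multiset ℕ, (∀ x ∈ u, x ∈ s) → (msum f u).card = u.card := by
          intro u hu
          rw [card_msum, msum_congr (g := fun _ => 1) fun x hxu => by
            have := hx x (hu x hxu); have := hf1 x; omega, msum_const, smul_eq_mul, mul_one]
        refine ⟨(hone s fun _ => id).trans hs, (hone t fun x => (h x).2).trans ht, fun x => ?_⟩
        simp only [mem_msum, h]
    · right; right
      rw [card_msum, card_msum]
      exact ⟨hs.trans_le (card_le_msum hf1 _), ht.trans_le (card_le_msum hf1 _)⟩
  zero {t} := by
    rintro (h | ⟨-, -, h⟩ | ⟨h, -⟩)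
    · exact h.symm
    · exact Multiset.eq_zero_of_forall_notMem fun x hx => by simpa using (h x).2 hx
    · simp at h

/-- The ideal generated by the words `xᵏy`, with `x` and `y` possibly equal, and by all words of
length greater than `k + 1`. -/
theorem isFIIdeal_longPower (k : ℕ) : IsFIIdeal {s : Multiset ℕ |
    k + 1 < s.card ∨ ∃ x y : ℕ, s = k • {x} + {y}} where
  ne_zero := by
    rintro s (h | ⟨x, y, h⟩) rfl
    · simp at h
    · simpa using congrArg Multiset.card h
  add_mem {s} t hs := by
    by_cases ht : t = 0
    · rwa [ht, add_zero]
    · have := one_le_card ht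
      left
      rw [Multiset.card_add]
      rcases hs with h | ⟨x, y, rfl⟩
      · omega
      · simp; omega
  subst {s} f hf hs := by
    have hf1 := fun n => one_le_card (hf n)
    rcases hs with h | ⟨x, y, rfl⟩
    · left
      rw [card_msum]
      exact h.trans_le (card_le_msum hf1 _)
    · by_cases hxy : 2 ≤ (f y).card
      · left
        rw [card_msum]
        refine lt_of_le_of_lt (le_of_eq ?_) (card_lt_msum hf1 (x := y) (by simp) hxy)
        simp
      · obtain ⟨b, hb⟩ := Multiset.card_eq_one.1 (le_antisymm (by omega) (hf1 y))
        by_cases hk : k = 0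
        · right
          exact ⟨b, b, by simp [hk, hb]⟩
        · by_cases hx : 2 ≤ (f x).card
          · left
            rw [card_msum]
            refine lt_of_le_of_lt (le_of_eq ?_) (card_lt_msum hf1 (x := x) ?_ hx)
            · simp
            · simp [Multiset.mem_nsmul, hk]
          · obtain ⟨a, ha⟩ := Multiset.card_eq_one.1 (le_antisymm (by omega) (hf1 x))
            right
            exact ⟨a, b, by rw [map_add, map_nsmul, msum_singleton, msum_singleton, ha, hb]⟩

/-- The additive congruence of a variety. -/
def ComVariety.addCon (V : ComVariety) : AddCon (Multiset ℕ) where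
  r := V.rel
  iseqv := ⟨V.isFI_rel.refl, V.isFI_rel.symm, V.isFI_rel.trans⟩
  add' h h' := V.isFI_rel.trans (V.isFI_rel.add_right _ h) (V.isFI_rel.add_left _ h')

theorem ComVariety.coe_eq_iff (V : ComVariety) {s t : Multiset ℕ} :
    (s : V.addCon.Quotient) = t ↔ V.rel s t := AddCon.eq V.addCon

/-- If a power of a letter absorbs the first power of another letter, then it is a zero. -/
theorem nil_of_absorbing {V : ComVariety} {N : ℕ} (hN : 1 ≤ N)
    (hab : ∀ p q : Multiset ℕ, p ≠ 0 → q ≠ 0 → V.rel (N • p) (N • p + N • q))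
    (h : V.rel (N • {0} + {1}) (N • {0} + {0})) :
    ∀ p q : Multiset ℕ, p ≠ 0 → q ≠ 0 → V.rel (N • p + q) (N • p) := by
  have fV := V.isFI_rel
  have key : ∀ p q : Multiset ℕ, p ≠ 0 → q ≠ 0 → V.rel (N • p + q) (N • p + p) := by
    intro p q hp hq
    have := fV.subst (fun n => if n = 0 then p else q) (fun n => by split_ifs <;> assumption) h
    simpa only [map_add, map_nsmul, msum_singleton, if_true, one_ne_zero, if_false] using this
  intro p q hp hq
  exact fV.trans (key p q hp hq) (fV.trans
    (fV.symm (key p _ hp (nsmul_ne_zero_of_pos hN hq))) (fV.symm (hab p q hp hq)))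

theorem IsLowerModular.nil {V : ComVariety} (hV : IsLowerModular V) (hS : ¬ semilatticeVar ≤ V) :
    ∃ N, 1 ≤ N ∧ ∀ p q : Multiset ℕ, p ≠ 0 → q ≠ 0 → V.rel (N • p + q) (N • p) := by
  have fV := V.isFI_rel
  obtain ⟨N, hN, hab⟩ := exists_absorbing hS
  refine ⟨N, hN, nil_of_absorbing hN hab ?_⟩
  by_contra hno
  have h0 : ({0} : Multiset ℕ) ≠ 0 := by simp
  have h1 : ({1} : Multiset ℕ) ≠ 0 := by simp
  have e1 := (V.coe_eq_iff).2 (hab {0} {1} h0 h1)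
  have e2 := (V.coe_eq_iff).2 (hab {1} {0} h1 h0)
  have e3 := (V.coe_eq_iff).2 (hab {0} {0} h0 h0)
  set a : V.addCon.Quotient := ↑(N • {0} : Multiset ℕ)
  set b : V.addCon.Quotient := ↑(N • {1} : Multiset ℕ)
  set A : V.addCon.Quotient := ↑({0} : Multiset ℕ)
  set B : V.addCon.Quotient := ↑({1} : Multiset ℕ)
  rw [AddCon.coe_add] at e1 e2 e3
  have hBb : B + ↑((N - 1) • {1} : Multiset ℕ) = b := by
    rw [← AddCon.coe_add, add_comm, ← succ_nsmul, Nat.sub_add_cancel hN]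
  have hab' : a = b := e1.trans ((add_comm a b).trans e2.symm)
  have hne : a + B + B ≠ a + A + B := fun h => hno ((V.coe_eq_iff).1 (by
    have h' := congrArg (· + (↑((N - 1) • {1} : Multiset ℕ) : V.addCon.Quotient)) h
    simp only [add_assoc, hBb] at h'
    rw [← hab', add_comm B, add_comm A, ← add_assoc, ← add_assoc, ← e3] at h'
    exact h'))
  have hu_coe : (↑(N • {0} + 2 • {1} : Multiset ℕ) : V.addCon.Quotient) = a + B + B := by
    rw [two_nsmul, ← add_assoc]; rfl
  -- `x ^ N * y ^ 2` is identified with neither `x ^ (N + 1) * y` nor `y ^ (N + 1) * x`.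
  have hne1 : ¬ V.rel (N • {0} + 2 • {1}) ((N + 1) • {0} + {1}) := fun h => hne (by
    rw [← hu_coe, (V.coe_eq_iff).2 h, succ_nsmul]; rfl)
  have hne2 : ¬ V.rel (N • {0} + 2 • {1}) ((N + 1) • {1} + {0}) := fun h => hne (by
    rw [← hu_coe, (V.coe_eq_iff).2 h, succ_nsmul, add_right_comm a, hab']; rfl)
  let J := reesVar _ (isFIIdeal_longPower (N + 1))
  let Z := ofRel _ (isFI_length (N + 2))
  set u : Multiset ℕ := N • {0} + 2 • {1} with hu
  set u' : Multiset ℕ := (N + 1) • {0} + {1} with hu'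
  have hcu : u.card = N + 2 := by simp [hu]
  have hcu' : u'.card = N + 2 := by simp [hu']
  have hsu : ∀ x, x ∈ u ↔ x = 0 ∨ x = 1 := fun x => by
    have hN0 : N ≠ 0 := by omega
    simp [hu, Multiset.mem_nsmul, hN0]
  have hsu' : ∀ x, x ∈ u' ↔ x = 0 ∨ x = 1 := fun x => by
    simp [hu', Multiset.mem_nsmul]
  have hpow : V.rel (N • {0}) (N • {0} + N • {0}) := hab _ _ h0 h0
  have hVu : V.rel u (u + N • {0}) := by
    rw [hu, add_right_comm]; exact fV.add_right _ hpow
  have hVu' : V.rel u' (u' + N • {0}) := by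
    rw [hu', succ_nsmul, add_assoc, add_right_comm]; exact fV.add_right _ hpow
  have hZ : Z.rel u u' := (rel_ofRel _).2 (Or.inr (Or.inl ⟨hcu, hcu', fun x => by
    rw [hsu, hsu']⟩))
  have hcN : ∀ s : Multiset ℕ, (s + N • {0}).card = s.card + N := fun s => by simp
  have hJu' : J.rel u' (u' + N • {0}) :=
    (rel_reesVar _).2 (Or.inr ⟨Or.inr ⟨0, 1, rfl⟩, Or.inl (by rw [hcN]; omega)⟩)
  have hleft : ((V ⊔ J) ⊓ Z).rel u (u + N • {0}) :=
    (isFI_rel _).trans (rel_inf_right hZ) ((isFI_rel _).trans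
      (rel_inf_left (rel_sup.2 ⟨hVu', hJu'⟩)) (rel_inf_right (Z.isFI_rel.symm
        (Z.isFI_rel.add_right _ hZ))))
  have hmod := hV (V ⊔ J) Z (sup_eq_right.2 le_sup_left)
  have hboth : (V ⊔ ((V ⊔ J) ⊓ Z)).rel u (u + N • {0}) := rel_sup.2 ⟨hVu, hleft⟩
  rw [← hmod] at hboth
  have hfin := rel_inf_induction
    (p := fun s => V.rel s u ∧ s.card = N + 2 ∧ ∀ x, x ∈ s ↔ x = 0 ∨ x = 1) ?_ ?_ hboth
    ⟨fV.refl _, hcu, hsu⟩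
  · have := hfin.2.1
    rw [hcN] at this
    omega
  · rintro s t hst ⟨hsV, hsc, hsx⟩
    obtain ⟨-, hJ⟩ := rel_sup.1 hst
    obtain rfl | ⟨hs | ⟨a, b, rfl⟩, -⟩ := (rel_reesVar _).1 hJ
    · exact ⟨hsV, hsc, hsx⟩
    · omega
    · exfalso
      simp only [Multiset.mem_add, Multiset.mem_nsmul, Multiset.mem_singleton] at hsx
      have ha := (hsx a).1 (by simp)
      have hb := (hsx b).1 (by simp)
      have hx0 := (hsx 0).2 (by simp)
      have hx1 := (hsx 1).2 (by simp)
      have : (a = 0 ∧ b = 1) ∨ (a = 1 ∧ b = 0) := by omega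
      obtain ⟨rfl, rfl⟩ | ⟨rfl, rfl⟩ := this
      · exact hne1 (fV.symm hsV)
      · exact hne2 (fV.symm hsV)
  · rintro s t hst ⟨hsV, hsc, hsx⟩
    obtain ⟨hV', hZ'⟩ := rel_sup.1 hst
    obtain rfl | ⟨-, h2, h3⟩ | ⟨h, -⟩ := (rel_ofRel _).1 hZ'
    · exact ⟨hsV, hsc, hsx⟩
    · exact ⟨fV.trans (fV.symm hV') hsV, h2, fun x => (h3 x).symm.trans (hsx x)⟩
    · omega

theorem IsLowerModular.exists_eq_reesVar {V : ComVariety} (hV : IsLowerModular V) {N : ℕ}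
    (hN : 1 ≤ N) (hnil : ∀ p q : Multiset ℕ, p ≠ 0 → q ≠ 0 → V.rel (N • p + q) (N • p)) :
    ∃ I, ∃ h : IsFIIdeal I, V = reesVar I h := by
  have fV := V.isFI_rel
  have h0 : ({0} : Multiset ℕ) ≠ 0 := by simp
  have hzero : ∀ p q : Multiset ℕ, p ≠ 0 → q ≠ 0 → V.rel (N • p) (N • q) := fun p q hp hq => by
    refine fV.trans (fV.symm (hnil p _ hp (nsmul_ne_zero_of_pos hN hq))) ?_
    rw [add_comm]; exact hnil q _ hq (nsmul_ne_zero_of_pos hN hp)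
  have hI : IsFIIdeal {s | V.rel s (N • {0})} :=
    { ne_zero := fun {s} hs => fV.ne_zero (fV.symm hs) (nsmul_ne_zero_of_pos hN h0)
      add_mem := fun {s} t hs => by
        by_cases ht : t = 0
        · rwa [ht, add_zero]
        · exact fV.trans (fV.add_right t hs) (hnil _ _ h0 ht)
      subst := fun {s} f hf hs => by
        have := fV.subst f hf hs
        rw [map_nsmul, msum_singleton] at this
        exact fV.trans this (hzero _ _ (hf 0) h0) }
  refine ⟨_, hI, le_antisymm (le_iff.2 fun s t hr => ?_) (le_iff.2 fun u v hr => ?_)⟩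
  · obtain rfl | ⟨hs, ht⟩ := (rel_reesVar hI).1 hr
    · exact fV.refl _
    · exact fV.trans hs (fV.symm ht)
  rw [rel_reesVar hI]
  by_contra! hc
  obtain ⟨huv, hc⟩ := hc
  have hu : ¬ V.rel u (N • {0}) := fun h => hc h (fV.trans (fV.symm hr) h)
  have hu0 : u ≠ 0 := by
    rintro rfl; exact huv (fV.zero hr).symm
  have hv0 : v ≠ 0 := fV.ne_zero hr hu0
  set n := N + u.card + v.card with hn
  have hmem : ∀ s : Multiset ℕ, V.rel (s + n • {0}) (N • {0}) := by
    intro s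
    have hle : N • ({0} : Multiset ℕ) + (u.card + v.card) • {0} = n • {0} := by
      rw [← add_nsmul, hn, add_assoc]
    have hpos := one_le_card hu0
    rw [← hle, add_left_comm]
    refine hnil {0} _ h0 ?_
    rw [Ne, add_eq_zero]
    exact fun h => nsmul_ne_zero_of_pos (by omega) h0 h.2
  have hright : (reesVar _ hI ⊓ groupVar n).rel u v :=
    (isFI_rel _).trans (rel_inf_right (groupVar_rel_add_nsmul hu0 {0}))
      ((isFI_rel _).trans (rel_inf_left ((rel_reesVar hI).2 (Or.inr ⟨hmem u, hmem v⟩)))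
        (rel_inf_right ((isFI_rel _).symm (groupVar_rel_add_nsmul hv0 {0}))))
  have hle : V ≤ reesVar _ hI := le_iff.2 fun s t h => by
    obtain rfl | ⟨hs, ht⟩ := (rel_reesVar hI).1 h
    · exact fV.refl _
    · exact fV.trans hs (fV.symm ht)
  have hboth := rel_sup.2 ⟨hr, hright⟩
  rw [← hV _ (groupVar n) (sup_eq_right.2 hle)] at hboth
  have hfin := rel_inf_induction (p := fun s => V.rel u s ∧ (groupVar n).rel u s) ?_ ?_ hboth
    ⟨fV.refl _, (isFI_rel _).refl _⟩
  · obtain ⟨-, a, b, hab⟩ := rel_groupVar.1 hfin.2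
    refine huv (Multiset.ext.2 fun x => ?_)
    have hx := congrArg (Multiset.count x) hab
    simp only [Multiset.count_add, Multiset.count_nsmul] at hx
    have hux := Multiset.count_le_card x u
    have hvx := Multiset.count_le_card x v
    have := congrArg (· % n) hx
    simp only [Nat.add_mul_mod_self_left] at this
    rwa [Nat.mod_eq_of_lt (by omega), Nat.mod_eq_of_lt (by omega)] at this
  · rintro s t hst ⟨h1, h2⟩
    obtain rfl | ⟨hs, -⟩ := (rel_reesVar hI).1 hst
    · exact ⟨h1, h2⟩
    · exact absurd (fV.trans h1 hs) hu
  · rintro s t hst ⟨h1, h2⟩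
    obtain ⟨h3, h4⟩ := rel_sup.1 hst
    exact ⟨fV.trans h1 h3, (isFI_rel _).trans h2 h4⟩

/-! ### The lattice characterization -/

/-- The lattice property defining the 0-reduced varieties. -/
def IsRigid {α : Type*} [Lattice α] [BoundedOrder α] (V : α) : Prop :=
  V = ⊤ ∨ (IsLowerModular V ∧ ∃ a U : α, IsLeastNonbot a U ∧ V ≤ U ∧ a ≠ U)

theorem isLeastNonbot_nullVar {U : ComVariety} (hU : U.rel ≤ nullVar.rel) {C : ℕ}
    (hnil : ∀ s t : Multiset ℕ, C • {0} ≤ s → C • {0} ≤ t → U.rel s t)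
    (hnil' : U.rel (C • {0}) (C • {1})) : IsLeastNonbot nullVar U := by
  refine ⟨fun h => ?_, le_iff.2 hU, fun X hX => ?_⟩
  · rcases rel_nullVar.1 (eq_bot_iff_rel.1 h {0} {1} (by simp) (by simp)) with h1 | h1 <;>
      simp at h1
  · by_contra! hc
    obtain ⟨hbot, hnull⟩ := hc
    have fX := X.isFI_rel
    obtain ⟨k, hk, hkX⟩ := exists_rel_nsmul hnull
    have hpow : ∀ (j : ℕ) (p : Multiset ℕ), X.rel p (k ^ j • p) := by
      intro j p
      induction j with
      | zero => simpa using fX.refl p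
      | succ j ih =>
        rw [pow_succ, mul_smul]
        have := hkX (k ^ j • p)
        rw [smul_comm] at this
        exact fX.trans ih this
    have hC' : C ≤ k ^ C := (Nat.lt_pow_self hk).le
    have hX0 : ∀ x : ℕ, X.rel {x} (C • {x}) := fun x => by
      refine fX.trans (hpow C _) ?_
      have := fX.subst (fun _ => {x}) (by simp) (le_iff.1 hX _ _
        (hnil (k ^ C • {0}) (C • {0}) (nsmul_le_nsmul_left zero_le hC') le_rfl))
      rwa [map_nsmul, map_nsmul, msum_singleton] at this
    exact hbot (eq_bot_of_rel (fX.trans (hX0 0)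
      (fX.trans (le_iff.1 hX _ _ hnil') (fX.symm (hX0 1)))))

theorem isZeroReduced_iff_isRigid {V : ComVariety} : IsZeroReduced V ↔ IsRigid V := by
  rw [isZeroReduced_iff]
  constructor
  · rintro ⟨I, hI, rfl⟩
    obtain rfl | ⟨z, hz⟩ := I.eq_empty_or_nonempty
    · exact Or.inl (eq_top_of_rel fun s t h => by simpa using (rel_reesVar hI).1 h)
    refine Or.inr ⟨isLowerModular_reesVar hI, nullVar,
      reesVar I hI ⊔ reesVar _ (isFIIdeal_card (k := 3) (by norm_num)), ?_, le_sup_left, ?_⟩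
    · have hpow : ∀ x, z.card • {x} ∈ I := fun x => by
        rw [← msum_const]; exact hI.subst _ (by simp) hz
      have hz1 := one_le_card (hI.ne_zero hz)
      have hpow' : ∀ x, (3 * z.card) • {x} ∈ I := fun x => by
        rw [show 3 * z.card = z.card + 2 * z.card by ring, add_nsmul]
        exact hI.add_mem _ (hpow x)
      have hmem : ∀ s, (3 * z.card) • {0} ≤ s → s ∈ I ∧ 3 ≤ s.card := by
        intro s hs
        have hc := Multiset.card_le_card hs
        obtain ⟨t, rfl⟩ := Multiset.le_iff_exists_add.1 hs
        refine ⟨hI.add_mem _ (hpow' 0), ?_⟩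
        rw [Multiset.card_nsmul, Multiset.card_singleton] at hc
        omega
      refine isLeastNonbot_nullVar ?_ (C := 3 * z.card) ?_ ?_
      · intro s t h
        rw [rel_nullVar]
        obtain h | ⟨h1, h2⟩ := (rel_reesVar _).1 (rel_sup.1 h).2
        · exact Or.inl h
        · exact Or.inr ⟨le_trans (by norm_num) h1, le_trans (by norm_num) h2⟩
      · intro s t hs ht
        obtain ⟨h1, h2⟩ := hmem s hs
        obtain ⟨h3, h4⟩ := hmem t ht
        exact rel_sup.2 ⟨(rel_reesVar hI).2 (Or.inr ⟨h1, h3⟩),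
          (rel_reesVar _).2 (Or.inr ⟨h2, h4⟩)⟩
      · exact rel_sup.2 ⟨(rel_reesVar hI).2 (Or.inr ⟨hpow' 0, hpow' 1⟩),
          (rel_reesVar _).2 (Or.inr (by simp; omega))⟩
    · intro h
      have h1 : nullVar.rel (2 • {0}) (2 • {1}) := rel_nullVar.2 (Or.inr (by simp))
      rw [h] at h1
      rcases (rel_reesVar _).1 (rel_sup.1 h1).2 with h2 | h2
      · simpa using congrArg (Multiset.count 0) h2
      · simp at h2
  · rintro (rfl | ⟨hV, a, U, ha, hVU, hne⟩)
    · refine ⟨∅, ⟨by simp, by simp, by simp⟩, (eq_top_of_rel fun s t h => ?_).symm⟩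
      simpa using (rel_reesVar _).1 h
    · have hS : ¬ semilatticeVar ≤ V := fun h => by
        have hU := ha.le_semilatticeVar (h.trans hVU)
        exact hne (le_antisymm ha.2.1 (hU.trans (semilatticeVar_le ha.1 (ha.2.1.trans hU))))
      obtain ⟨N, hN, hnil⟩ := hV.nil hS
      exact hV.exists_eq_reesVar hN hnil

/-! ### Definability -/

section Formulas

open FirstOrder.Language

variable {α : Type} {n : ℕ}

/-- The term `s ∨ t`. -/
def joinTerm (s t : latticeLang.Term α) : latticeLang.Term α :=
  Functions.apply₂ (L := latticeLang) (true : Bool) s t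

/-- The term `s ∧ t`. -/
def meetTerm (s t : latticeLang.Term α) : latticeLang.Term α :=
  Functions.apply₂ (L := latticeLang) (false : Bool) s t

theorem realize_joinTerm {L : Type*} [Lattice L] (s t : latticeLang.Term α) (v : α → L) :
    (joinTerm s t).realize v = s.realize v ⊔ t.realize v :=
  Term.realize_functions_apply₂

theorem realize_meetTerm {L : Type*} [Lattice L] (s t : latticeLang.Term α) (v : α → L) :
    (meetTerm s t).realize v = s.realize v ⊓ t.realize v :=
  Term.realize_functions_apply₂

/-- The formula `s ≤ t`. -/
def leFormula (s t : latticeLang.Term (α ⊕ Fin n)) : latticeLang.BoundedFormula α n :=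
  (joinTerm s t).bdEqual t

theorem realize_leFormula {L : Type*} [Lattice L] (s t : latticeLang.Term (α ⊕ Fin n))
    (v : α → L) (xs : Fin n → L) : (leFormula s t).Realize v xs ↔
      s.realize (Sum.elim v xs) ≤ t.realize (Sum.elim v xs) := by
  rw [leFormula, BoundedFormula.realize_bdEqual, realize_joinTerm, sup_eq_right]

/-- The free variable. -/
def freeVar : latticeLang.Term (Fin 1 ⊕ Fin n) := Term.var (Sum.inl 0)

/-- The `i`-th quantified variable. -/
def boundVar (i : Fin n) : latticeLang.Term (α ⊕ Fin n) := Term.var (Sum.inr i)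

/-- A formula expressing `IsRigid`. -/
def rigidFormula : latticeLang.Formula (Fin 1) :=
  (leFormula (boundVar 0) freeVar : latticeLang.BoundedFormula (Fin 1) 1).all ⊔
  ((((leFormula freeVar (boundVar 0)).imp
      ((meetTerm (boundVar 0) (joinTerm freeVar (boundVar 1))).bdEqual
        (joinTerm freeVar (meetTerm (boundVar 0) (boundVar 1)))) :
        latticeLang.BoundedFormula (Fin 1) 2).all.all) ⊓
    ((((leFormula (boundVar 0) (boundVar 2) : latticeLang.BoundedFormula (Fin 1) 3).all.not ⊓
      (leFormula (boundVar 0) (boundVar 1) ⊓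
        ((leFormula (boundVar 2) (boundVar 1)).imp
          ((leFormula (boundVar 2) (boundVar 3) : latticeLang.BoundedFormula (Fin 1) 4).all ⊔
            leFormula (boundVar 0) (boundVar 2))).all)) ⊓
      (leFormula freeVar (boundVar 1) ⊓ ((boundVar 0).bdEqual (boundVar 1)).not)).ex.ex))

theorem realize_rigidFormula {L : Type*} [Lattice L] [BoundedOrder L] (a : L) :
    rigidFormula.Realize (fun _ => a) ↔ IsRigid a := by
  simp only [rigidFormula, Formula.Realize, BoundedFormula.realize_sup, BoundedFormula.realize_inf,
    BoundedFormula.realize_all, BoundedFormula.realize_ex, BoundedFormula.realize_not,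
    BoundedFormula.realize_imp, BoundedFormula.realize_bdEqual, realize_leFormula,
    realize_joinTerm, realize_meetTerm, freeVar, boundVar, Term.realize_var, Sum.elim_inl,
    Sum.elim_inr, IsRigid, IsLowerModular, IsLeastNonbot, sup_eq_right, ne_eq]
  have top_iff : ∀ x : L, (∀ y, y ≤ x) ↔ x = ⊤ := fun x =>
    ⟨fun h => top_le_iff.1 (h ⊤), fun h y => h ▸ le_top⟩
  have bot_iff : ∀ x : L, (∀ y, x ≤ y) ↔ x = ⊥ := fun x =>
    ⟨fun h => le_bot_iff.1 (h ⊥), fun h y => h ▸ bot_le⟩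
  simp only [← top_iff, ← bot_iff]
  rfl

end Formulas

/-- **Theorem.** The set of all commutative semigroup varieties that are 0-reduced in
**Com** (i.e. given within the variety of all commutative semigroups by 0-reduced
identities only) is definable in the lattice **Com**. -/
theorem definable_zero_reduced :
    LatDefinable ComVariety {V : ComVariety | IsZeroReduced V} := by
  exact ⟨rigidFormula, fun _ =>
    (realize_rigidFormula _).trans isZeroReduced_iff_isRigid.symm⟩
end
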